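/- arXiv:2402.09796 — 8 statements merged into one kernel-verified Lean document; each statement's English description precedes it below -/
import Mathlib

section
/- Let f be a Gaussian PSD model of order M1 on ℝ^{d1} × ℝ^{d2}, i.e. f(x,y) = Σ_{i=1}^{M1} Σ_{j=1}^{M1} A_{ij} k_{η1}(x, a_i) k_{η2}(y, b_i) k_{η1}(x, a_j) k_{η2}(y, b_j) with A an M1×M1 real positive semidefinite matrix, anchor points (a_i, b_i) ∈ ℝ^{d1} × ℝ^{d2} and precision vectors η1 ∈ ℝ_{>0}^{d1}, η2 ∈ ℝ_{>0}^{d2}, and let g be a Gaussian PSD model of order M2 on ℝ^{d2} × ℝ^{d3} with weight matrix A', anchors (b'_k, c_k) and precision vectors (η2', η3). Then the pointwise product h(x,y,z) = f(x,y) · g(y,z) is a Gaussian PSD model of order at most M1 · M2 on ℝ^{d1} × ℝ^{d2} × ℝ^{d3}: there exist an (M1·M2)×(M1·M2) real positive semidefinite matrix B, anchor points in ℝ^{d1+d2+d3}, and a precision vector in ℝ_{>0}^{d1+d2+d3} representing h in the same form. -/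
open MeasureTheory Matrix
open scoped BigOperators

noncomputable section

/-- The Gaussian kernel with precision vector `η`. -/
def gk {ι : Type*} [Fintype ι] (η : ι → ℝ) (x x' : ι → ℝ) : ℝ :=
  Real.exp (-∑ l, η l * (x l - x' l) ^ 2)

/-- The product of two Gaussian kernels in the same variable is a multiple of a Gaussian kernel. -/
theorem gk_mul_gk {ι : Type*} [Fintype ι] {η η' : ι → ℝ} (hη : ∀ l, 0 < η l)
    (hη' : ∀ l, 0 < η' l) (y b b' : ι → ℝ) :
    gk η y b * gk η' y b' =
      Real.exp (-∑ l, η l * η' l / (η l + η' l) * (b l - b' l) ^ 2) *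
        gk (η + η') y (fun l => (η l * b l + η' l * b' l) / (η l + η' l)) := by
  simp only [gk, ← Real.exp_add, ← Finset.sum_neg_distrib, ← Finset.sum_add_distrib]
  congr 1
  refine Finset.sum_congr rfl fun l _ => ?_
  have h : η l + η' l ≠ 0 := (add_pos (hη l) (hη' l)).ne'
  simp only [Pi.add_apply]
  field_simp
  ring

/-- The entrywise product of pulled back positive semidefinite matrices, scaled by a rank one
matrix `w wᵀ`, is positive semidefinite. -/
theorem posSemidef_scaled_kronecker {m n p : Type*} [Fintype m] [Fintype n] [Fintype p]
    [DecidableEq p] {A : Matrix m m ℝ} {A' : Matrix n n ℝ} (hA : A.PosSemidef)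
    (hA' : A'.PosSemidef) (w : p → ℝ) (e : p → m × n) :
    (Matrix.of fun i j =>
      w i * (A (e i).1 (e j).1 * A' (e i).2 (e j).2) * w j).PosSemidef := by
  have h : (diagonal w * (Matrix.kronecker A A').submatrix e e * (diagonal w)ᴴ).PosSemidef :=
    PosSemidef.mul_mul_conjTranspose_same (PosSemidef.submatrix (hA.kronecker hA') e) _
  have heq : (Matrix.of fun i j =>
      w i * (A (e i).1 (e j).1 * A' (e i).2 (e j).2) * w j) =
      diagonal w * (Matrix.kronecker A A').submatrix e e * (diagonal w)ᴴ := by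
    ext i j
    simp [diagonal_mul, mul_diagonal]
  rwa [heq]

/-- the pointwise product of a Gaussian PSD model of order `M1` on
`ℝ^{d1} × ℝ^{d2}` with a Gaussian PSD model of order `M2` on `ℝ^{d2} × ℝ^{d3}` is a
Gaussian PSD model of order at most `M1 * M2` on `ℝ^{d1} × ℝ^{d2} × ℝ^{d3}`. -/
theorem product_of_gaussian_psd_models
    (d1 d2 d3 M1 M2 : ℕ)
    (A : Matrix (Fin M1) (Fin M1) ℝ) (hA : A.PosSemidef)
    (a : Fin M1 → Fin d1 → ℝ) (b : Fin M1 → Fin d2 → ℝ)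
    (η1 : Fin d1 → ℝ) (η2 : Fin d2 → ℝ)
    (hη1 : ∀ l, 0 < η1 l) (hη2 : ∀ l, 0 < η2 l)
    (A' : Matrix (Fin M2) (Fin M2) ℝ) (hA' : A'.PosSemidef)
    (b' : Fin M2 → Fin d2 → ℝ) (c : Fin M2 → Fin d3 → ℝ)
    (η2' : Fin d2 → ℝ) (η3 : Fin d3 → ℝ)
    (hη2' : ∀ l, 0 < η2' l) (hη3 : ∀ l, 0 < η3 l)
    (f : (Fin d1 → ℝ) → (Fin d2 → ℝ) → ℝ)
    (hf : ∀ x y, f x y = ∑ i, ∑ j, A i j *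
      (gk η1 x (a i) * gk η2 y (b i)) * (gk η1 x (a j) * gk η2 y (b j)))
    (g : (Fin d2 → ℝ) → (Fin d3 → ℝ) → ℝ)
    (hg : ∀ y z, g y z = ∑ k, ∑ l, A' k l *
      (gk η2' y (b' k) * gk η3 z (c k)) * (gk η2' y (b' l) * gk η3 z (c l))) :
    ∃ (B : Matrix (Fin (M1 * M2)) (Fin (M1 * M2)) ℝ)
      (pa : Fin (M1 * M2) → Fin d1 → ℝ) (pb : Fin (M1 * M2) → Fin d2 → ℝ)
      (pc : Fin (M1 * M2) → Fin d3 → ℝ)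
      (ζ1 : Fin d1 → ℝ) (ζ2 : Fin d2 → ℝ) (ζ3 : Fin d3 → ℝ),
      B.PosSemidef ∧ (∀ l, 0 < ζ1 l) ∧ (∀ l, 0 < ζ2 l) ∧ (∀ l, 0 < ζ3 l) ∧
      ∀ x y z, f x y * g y z = ∑ i, ∑ j, B i j *
        (gk ζ1 x (pa i) * gk ζ2 y (pb i) * gk ζ3 z (pc i)) *
        (gk ζ1 x (pa j) * gk ζ2 y (pb j) * gk ζ3 z (pc j)) := by
  let e : Fin (M1 * M2) ≃ Fin M1 × Fin M2 := finProdFinEquiv.symm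
  let w : Fin M1 × Fin M2 → ℝ := fun p =>
    Real.exp (-∑ l, η2 l * η2' l / (η2 l + η2' l) * (b p.1 l - b' p.2 l) ^ 2)
  let m : Fin M1 × Fin M2 → Fin d2 → ℝ := fun p l =>
    (η2 l * b p.1 l + η2' l * b' p.2 l) / (η2 l + η2' l)
  refine ⟨_, fun p => a (e p).1, fun p => m (e p), fun p => c (e p).2, η1, η2 + η2', η3,
    posSemidef_scaled_kronecker hA hA' (fun p => w (e p)) e, hη1,
    fun l => add_pos (hη2 l) (hη2' l), hη3, fun x y z => ?_⟩
  have key (p : Fin M1 × Fin M2) :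
      gk η2 y (b p.1) * gk η2' y (b' p.2) = w p * gk (η2 + η2') y (m p) :=
    gk_mul_gk hη2 hη2' y (b p.1) (b' p.2)
  simp only [of_apply]
  rw [e.sum_comp fun p => ∑ j, w p * (A p.1 (e j).1 * A' p.2 (e j).2) * w (e j) *
    (gk η1 x (a p.1) * gk (η2 + η2') y (m p) * gk η3 z (c p.2)) *
    (gk η1 x (a (e j).1) * gk (η2 + η2') y (m (e j)) * gk η3 z (c (e j).2)),
    hf, hg, Finset.sum_mul_sum, ← Finset.sum_product', Finset.univ_product_univ]
  refine Finset.sum_congr rfl fun p _ => ?_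
  rw [e.sum_comp fun q => w p * (A p.1 q.1 * A' p.2 q.2) * w q *
    (gk η1 x (a p.1) * gk (η2 + η2') y (m p) * gk η3 z (c p.2)) *
    (gk η1 x (a q.1) * gk (η2 + η2') y (m q) * gk η3 z (c q.2)),
    Finset.sum_mul_sum, ← Finset.sum_product', Finset.univ_product_univ]
  refine Finset.sum_congr rfl fun q _ => ?_
  calc
    _ = A p.1 q.1 * A' p.2 q.2 * (gk η2 y (b p.1) * gk η2' y (b' p.2)) *
        (gk η2 y (b q.1) * gk η2' y (b' q.2)) *
        (gk η1 x (a p.1) * gk η3 z (c p.2)) * (gk η1 x (a q.1) * gk η3 z (c q.2)) := by ring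
    _ = _ := by rw [key, key]; ring
end
end

section
/- Let f(x) = Σ_{i,j=1}^{M} A_{ij} k_η(x, x_i) k_η(x, x_j) be a Gaussian PSD model of order M on ℝ^d with A positive semidefinite and η ∈ ℝ_{>0}^d. Then f is Lebesgue-integrable on ℝ^d and ∫_{ℝ^d} f(x) dx = Σ_{i,j=1}^{M} A_{ij} · (Π_{l=1}^{d} √(π/(2 η_l))) · exp(−(1/2) Σ_{l=1}^{d} η_l (x_{il} − x_{jl})²). -/
open MeasureTheory Matrix
open scoped BigOperators

noncomputable section

/-- The product of two univariate Gaussians, with the square completed around their midpoint. -/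
lemma exp_neg_mul_sq_mul_exp_neg_mul_sq (η a b t : ℝ) :
    Real.exp (-(η * (t - a) ^ 2)) * Real.exp (-(η * (t - b) ^ 2)) =
      Real.exp (-(1 / 2) * (η * (a - b) ^ 2)) *
        Real.exp (-(2 * η) * (t - (a + b) / 2) ^ 2) := by
  rw [← Real.exp_add, ← Real.exp_add]
  ring_nf

lemma integrable_exp_neg_mul_sq_mul {η : ℝ} (hη : 0 < η) (a b : ℝ) :
    Integrable fun t : ℝ => Real.exp (-(η * (t - a) ^ 2)) * Real.exp (-(η * (t - b) ^ 2)) := by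
  simp_rw [exp_neg_mul_sq_mul_exp_neg_mul_sq]
  exact ((integrable_exp_neg_mul_sq (b := 2 * η) (by positivity)).comp_sub_right _).const_mul _

lemma integral_exp_neg_mul_sq_mul (η a b : ℝ) :
    ∫ t : ℝ, Real.exp (-(η * (t - a) ^ 2)) * Real.exp (-(η * (t - b) ^ 2)) =
      Real.sqrt (Real.pi / (2 * η)) * Real.exp (-(1 / 2) * (η * (a - b) ^ 2)) := by
  simp_rw [exp_neg_mul_sq_mul_exp_neg_mul_sq]
  rw [integral_const_mul,
    integral_sub_right_eq_self (fun t : ℝ => Real.exp (-(2 * η) * t ^ 2)) ((a + b) / 2),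
    integral_gaussian, mul_comm]

lemma gk_mul_gk_s3 {ι : Type*} [Fintype ι] (η x y z : ι → ℝ) :
    gk η x y * gk η x z =
      ∏ l, Real.exp (-(η l * (x l - y l) ^ 2)) * Real.exp (-(η l * (x l - z l) ^ 2)) := by
  simp_rw [gk, ← Finset.sum_neg_distrib, Real.exp_sum, Finset.prod_mul_distrib]

lemma integrable_gk_mul_gk {ι : Type*} [Fintype ι] {η : ι → ℝ} (hη : ∀ l, 0 < η l)
    (y z : ι → ℝ) : Integrable fun x => gk η x y * gk η x z := by
  simp_rw [gk_mul_gk_s3]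
  exact Integrable.fintype_prod
    (f := fun l t => Real.exp (-(η l * (t - y l) ^ 2)) * Real.exp (-(η l * (t - z l) ^ 2)))
    fun l => integrable_exp_neg_mul_sq_mul (hη l) (y l) (z l)

lemma integral_gk_mul_gk {ι : Type*} [Fintype ι] (η y z : ι → ℝ) :
    ∫ x, gk η x y * gk η x z = (∏ l, Real.sqrt (Real.pi / (2 * η l))) *
      Real.exp (-(1 / 2) * ∑ l, η l * (y l - z l) ^ 2) := by
  simp_rw [gk_mul_gk_s3]
  rw [integral_fintype_prod_volume_eq_prod
    (fun l t => Real.exp (-(η l * (t - y l) ^ 2)) * Real.exp (-(η l * (t - z l) ^ 2)))]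
  simp_rw [integral_exp_neg_mul_sq_mul, Finset.prod_mul_distrib, Finset.mul_sum, Real.exp_sum]

/-- a Gaussian PSD model of order `M` on `ℝ^d` is Lebesgue-integrable and
its integral over `ℝ^d` is given by the stated closed-form expression. -/
theorem integral_of_gaussian_psd_model
    (d M : ℕ)
    (A : Matrix (Fin M) (Fin M) ℝ) (hA : A.PosSemidef)
    (xs : Fin M → Fin d → ℝ)
    (η : Fin d → ℝ) (hη : ∀ l, 0 < η l)
    (f : (Fin d → ℝ) → ℝ)
    (hf : ∀ x, f x = ∑ i, ∑ j, A i j * gk η x (xs i) * gk η x (xs j)) :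
    Integrable f ∧
      (∫ x : Fin d → ℝ, f x) = ∑ i, ∑ j, A i j *
        (∏ l, Real.sqrt (Real.pi / (2 * η l))) *
        Real.exp (-(1 / 2) * ∑ l, η l * (xs i l - xs j l) ^ 2) := by
  obtain rfl : f = _ := funext hf
  simp_rw [mul_assoc]
  have hint (i j : Fin M) : Integrable fun x => A i j * (gk η x (xs i) * gk η x (xs j)) :=
    (integrable_gk_mul_gk hη _ _).const_mul _
  have hsum (i : Fin M) : Integrable fun x => ∑ j, A i j * (gk η x (xs i) * gk η x (xs j)) :=
    integrable_finsetSum _ fun j _ => hint i j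
  refine ⟨integrable_finsetSum _ fun i _ => hsum i, ?_⟩
  rw [integral_finsetSum _ fun i _ => hsum i]
  refine Finset.sum_congr rfl fun i _ => ?_
  rw [integral_finsetSum _ fun j _ => hint i j]
  simp_rw [integral_const_mul, integral_gk_mul_gk]
end
end

section
/- Let Q(u,x) be a Gaussian PSD model of order M1 on ℝ^d × ℝ^d with weight matrix A positive semidefinite, anchors (u_i, x_i) and precision vectors (η1, η2), and let f(u) be a Gaussian PSD model of order M2 on ℝ^d (in particular f is nonnegative and integrable). Then g(x) = ∫_{ℝ^d} Q(u,x) f(u) du is a Gaussian PSD model of order at most M1 (not M1·M2): explicitly, g(x) = Σ_{i,j=1}^{M1} (A_{ij} C_{ij}) k_{η2}(x, x_i) k_{η2}(x, x_j), where C_{ij} = ∫_{ℝ^d} k_{η1}(u, u_i) k_{η1}(u, u_j) f(u) du, and the Hadamard product matrix (A_{ij} C_{ij})_{ij} is positive semidefinite. -/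
open MeasureTheory Matrix
open scoped BigOperators

noncomputable section

theorem gk_nonneg {ι : Type*} [Fintype ι] (η x x' : ι → ℝ) : 0 ≤ gk η x x' :=
  (Real.exp_pos _).le

theorem gk_le_one {ι : Type*} [Fintype ι] {η : ι → ℝ} (hη : ∀ l, 0 < η l) (x x' : ι → ℝ) :
    gk η x x' ≤ 1 := by
  refine Real.exp_le_one_iff.2 (neg_nonpos.2 (Finset.sum_nonneg fun l _ => ?_))
  exact mul_nonneg (hη l).le (sq_nonneg _)

theorem continuous_gk {ι : Type*} [Fintype ι] (η x' : ι → ℝ) :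
    Continuous fun x => gk η x x' := by
  unfold gk
  fun_prop

theorem norm_gk_le_one {ι : Type*} [Fintype ι] {η : ι → ℝ} (hη : ∀ l, 0 < η l)
    (x x' : ι → ℝ) : ‖gk η x x'‖ ≤ 1 := by
  rw [Real.norm_of_nonneg (gk_nonneg η x x')]
  exact gk_le_one hη x x'

theorem integrable_gk {ι : Type*} [Fintype ι] {η : ι → ℝ} (hη : ∀ l, 0 < η l) (x' : ι → ℝ) :
    Integrable fun x => gk η x x' := by
  have h : ∀ l, Integrable fun t : ℝ => Real.exp (-η l * (t - x' l) ^ 2) := fun l =>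
    (integrable_exp_neg_mul_sq (hη l)).comp_sub_right (x' l)
  refine (Integrable.fintype_prod h).congr (Filter.Eventually.of_forall fun x => ?_)
  simp only [gk, ← Real.exp_sum, neg_mul, Finset.sum_neg_distrib]

/-- Multiplying an integrable function by a Gaussian kernel preserves integrability. -/
theorem MeasureTheory.Integrable.gk_mul {ι : Type*} [Fintype ι] {η : ι → ℝ}
    (hη : ∀ l, 0 < η l) (x' : ι → ℝ) {f : (ι → ℝ) → ℝ} (hf : Integrable f) :
    Integrable fun x => gk η x x' * f x :=
  hf.bdd_mul (continuous_gk η x').aestronglyMeasurable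
    (Filter.Eventually.of_forall fun x => norm_gk_le_one hη x x')

/-- The quadratic form of a real positive semidefinite matrix, as a double sum. -/
theorem Matrix.PosSemidef.sum_sum_nonneg {n : Type*} [Fintype n] {A : Matrix n n ℝ}
    (hA : A.PosSemidef) (v : n → ℝ) : 0 ≤ ∑ i, ∑ j, A i j * v i * v j := by
  have h := hA.dotProduct_mulVec_nonneg v
  simp only [dotProduct, mulVec, Finset.mul_sum, Pi.star_apply, star_trivial] at h
  refine h.trans_eq (Finset.sum_congr rfl fun i _ => Finset.sum_congr rfl fun j _ => ?_)
  ring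

/-- The Gram matrix of real functions with respect to a nonnegative weight is positive
semidefinite. -/
theorem Matrix.posSemidef_integral_mul_mul {α n : Type*} [Fintype n] [MeasurableSpace α]
    {μ : Measure α} {φ : n → α → ℝ} {f : α → ℝ} (hf : ∀ a, 0 ≤ f a)
    (hint : ∀ i j, Integrable (fun a => φ i a * φ j a * f a) μ) :
    (Matrix.of fun i j => ∫ a, φ i a * φ j a * f a ∂μ).PosSemidef := by
  refine .of_dotProduct_mulVec_nonneg ?_ fun v => ?_
  · ext i j
    simp [mul_comm (φ i _)]
  · have h : star v ⬝ᵥ (Matrix.of fun i j => ∫ a, φ i a * φ j a * f a ∂μ) *ᵥ v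
        = ∫ a, (∑ i, v i * φ i a) ^ 2 * f a ∂μ := by
      have hexp : ∀ a, (∑ i, v i * φ i a) ^ 2 * f a
          = ∑ i, ∑ j, (v i * v j) * (φ i a * φ j a * f a) := fun a => by
        rw [sq, Finset.sum_mul_sum, Finset.sum_mul]
        refine Finset.sum_congr rfl fun i _ => ?_
        rw [Finset.sum_mul]
        exact Finset.sum_congr rfl fun j _ => by ring
      simp only [hexp]
      rw [integral_finsetSum _ fun i _ =>
        integrable_finsetSum _ fun j _ => (hint i j).const_mul _]
      simp only [dotProduct, mulVec, Finset.mul_sum, Pi.star_apply, star_trivial, of_apply]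
      refine Finset.sum_congr rfl fun i _ => ?_
      rw [integral_finsetSum _ fun j _ => (hint i j).const_mul _]
      refine Finset.sum_congr rfl fun j _ => ?_
      rw [integral_const_mul]
      ring
    rw [h]
    exact integral_nonneg fun a => mul_nonneg (sq_nonneg _) (hf a)

/-- if `Q(u,x)` is a Gaussian PSD model of order `M1` on `ℝ^d × ℝ^d` and
`f` is a Gaussian PSD model of order `M2` on `ℝ^d`, then
`g(x) = ∫ Q(u,x) f(u) du` is a Gaussian PSD model of order at most `M1`, with weight
matrix the Hadamard product `(A_{ij} C_{ij})_{ij}`, which is positive semidefinite. -/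
theorem markov_transition_constant_order
    (d M1 M2 : ℕ)
    (A : Matrix (Fin M1) (Fin M1) ℝ) (hA : A.PosSemidef)
    (ua : Fin M1 → Fin d → ℝ) (xa : Fin M1 → Fin d → ℝ)
    (η1 : Fin d → ℝ) (η2 : Fin d → ℝ)
    (hη1 : ∀ l, 0 < η1 l) (hη2 : ∀ l, 0 < η2 l)
    (Q : (Fin d → ℝ) → (Fin d → ℝ) → ℝ)
    (hQ : ∀ u x, Q u x = ∑ i, ∑ j, A i j *
      (gk η1 u (ua i) * gk η2 x (xa i)) * (gk η1 u (ua j) * gk η2 x (xa j)))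
    (A2 : Matrix (Fin M2) (Fin M2) ℝ) (hA2 : A2.PosSemidef)
    (pts : Fin M2 → Fin d → ℝ)
    (η0 : Fin d → ℝ) (hη0 : ∀ l, 0 < η0 l)
    (f : (Fin d → ℝ) → ℝ)
    (hfdef : ∀ u, f u = ∑ i, ∑ j, A2 i j * gk η0 u (pts i) * gk η0 u (pts j))
    (Cmat : Matrix (Fin M1) (Fin M1) ℝ)
    (hCdef : ∀ i j, Cmat i j = ∫ u : Fin d → ℝ, gk η1 u (ua i) * gk η1 u (ua j) * f u) :
    (Matrix.of fun i j => A i j * Cmat i j).PosSemidef ∧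
      ∀ x, (∫ u : Fin d → ℝ, Q u x * f u) =
        ∑ i, ∑ j, A i j * Cmat i j * gk η2 x (xa i) * gk η2 x (xa j) := by
  have hf_nonneg : ∀ u, 0 ≤ f u := fun u => by
    rw [hfdef]
    exact hA2.sum_sum_nonneg fun i => gk η0 u (pts i)
  have hf_int : Integrable f := by
    rw [funext hfdef]
    refine integrable_finsetSum _ fun i _ => integrable_finsetSum _ fun j _ => ?_
    simpa only [mul_assoc] using
      ((integrable_gk hη0 (pts j)).gk_mul hη0 (pts i)).const_mul (A2 i j)
  have hint : ∀ i j, Integrable fun u => gk η1 u (ua i) * gk η1 u (ua j) * f u := fun i j => by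
    simpa only [mul_assoc] using (hf_int.gk_mul hη1 (ua j)).gk_mul hη1 (ua i)
  refine ⟨?_, fun x => ?_⟩
  · have hC : Cmat.PosSemidef := by
      convert posSemidef_integral_mul_mul (φ := fun i u => gk η1 u (ua i)) hf_nonneg hint
      ext i j
      exact hCdef i j
    exact hA.hadamard hC
  · have hexp : ∀ u, Q u x * f u = ∑ i, ∑ j, (A i j * gk η2 x (xa i) * gk η2 x (xa j)) *
        (gk η1 u (ua i) * gk η1 u (ua j) * f u) := fun u => by
      rw [hQ, Finset.sum_mul]
      refine Finset.sum_congr rfl fun i _ => ?_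
      rw [Finset.sum_mul]
      exact Finset.sum_congr rfl fun j _ => by ring
    simp only [hexp]
    rw [integral_finsetSum _ fun i _ =>
      integrable_finsetSum _ fun j _ => (hint i j).const_mul _]
    refine Finset.sum_congr rfl fun i _ => ?_
    rw [integral_finsetSum _ fun j _ => (hint i j).const_mul _]
    refine Finset.sum_congr rfl fun j _ => ?_
    rw [integral_const_mul, hCdef]
    ring
end
end

section
/- Let f(x,y) = Σ_{i,j=1}^{M1} A_{ij} exp(C_{ij}) exp(−(w − w_{ij})ᵀ P_{ij} (w − w_{ij})) (with w = (x,y) ∈ ℝ^{d1+d2}) be a Generalized Gaussian PSD model of order M1, i.e. A is positive semidefinite and the M1×M1 matrix B(x,y) with entries B(x,y)_{ij} = exp(C_{ij}) exp(−(w − w_{ij})ᵀ P_{ij} (w − w_{ij})) is positive semidefinite for every (x,y); similarly let g(y,z) be a Generalized Gaussian PSD model of order M2 on ℝ^{d2+d3}. Then the product h(x,y,z) = f(x,y) · g(y,z) is a Generalized Gaussian PSD model of order at most M1 · M2 on ℝ^{d1+d2+d3}: there exist a positive semidefinite (M1·M2)×(M1·M2) weight matrix A', constants C'_{kl}, centers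 in ℝ^{d1+d2+d3} and positive semidefinite precision matrices representing h in the same form with the associated matrix B'(x,y,z) positive semidefinite for every (x,y,z). -/
open MeasureTheory Matrix
open scoped BigOperators Matrix

noncomputable section

/-- An entry of the matrix `B(w)` of a Generalized Gaussian PSD model:
`exp(C) · exp(−(w − m)ᵀ P (w − m))`. -/
def gEntry {ι : Type*} [Fintype ι] (C : ℝ) (m : ι → ℝ) (P : Matrix ι ι ℝ)
    (w : ι → ℝ) : ℝ :=
  Real.exp C * Real.exp (-((w - m) ⬝ᵥ P.mulVec (w - m)))

/-- Completing the square: by solvability of the normal equations, a least-squares functional is a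
quadratic form in the distance to a minimizer, up to an additive constant. -/
lemma exists_sq_eq_quadForm_add_const {σ κ : Type*} [Fintype σ] [Fintype κ]
    (X : Matrix σ κ ℝ) (u : σ → ℝ) :
    ∃ (c : κ → ℝ) (t : ℝ), ∀ w : κ → ℝ,
      (X *ᵥ w - u) ⬝ᵥ (X *ᵥ w - u) = (w - c) ⬝ᵥ (Xᵀ * X) *ᵥ (w - c) + t := by
  have hrange : LinearMap.range (Xᵀ * X).mulVecLin = LinearMap.range Xᵀ.mulVecLin := by
    apply Submodule.eq_of_le_of_finrank_eq
    · rw [Matrix.mulVecLin_mul]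
      exact LinearMap.range_comp_le_range _ _
    · exact (Matrix.rank_transpose_mul_self X).trans (Matrix.rank_transpose X).symm
  obtain ⟨c, hc⟩ : Xᵀ.mulVecLin u ∈ LinearMap.range (Xᵀ * X).mulVecLin :=
    hrange ▸ LinearMap.mem_range_self _ u
  simp only [Matrix.mulVecLin_apply, ← Matrix.mulVec_mulVec] at hc
  have horth (v : κ → ℝ) : X *ᵥ v ⬝ᵥ (X *ᵥ c - u) = 0 := by
    rw [← Matrix.vecMul_transpose, ← Matrix.dotProduct_mulVec, Matrix.mulVec_sub, hc, sub_self,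
      dotProduct_zero]
  refine ⟨c, (X *ᵥ c - u) ⬝ᵥ (X *ᵥ c - u), fun w => ?_⟩
  have hsplit : X *ᵥ w - u = X *ᵥ (w - c) + (X *ᵥ c - u) := by
    rw [Matrix.mulVec_sub]; abel
  rw [hsplit, add_dotProduct, dotProduct_add, dotProduct_add, horth,
    dotProduct_comm (X *ᵥ c - u) (X *ᵥ (w - c)), horth, add_zero, zero_add,
    ← Matrix.mulVec_mulVec, Matrix.dotProduct_mulVec (w - c), Matrix.vecMul_transpose]

lemma Matrix.PosSemidef.exists_transpose_mul_self {ι : Type*} [Fintype ι]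
    {P : Matrix ι ι ℝ} (hP : P.PosSemidef) : ∃ R : Matrix ι ι ℝ, P = Rᵀ * R := by
  classical
  open scoped MatrixOrder in
  obtain ⟨R, hR⟩ := CStarAlgebra.nonneg_iff_eq_star_mul_self.mp hP.nonneg
  exact ⟨R, by simpa [Matrix.star_eq_conjTranspose] using hR⟩

lemma dotProduct_transpose_mul_self_mulVec {σ κ : Type*} [Fintype σ] [Fintype κ]
    (R : Matrix σ κ ℝ) (v : κ → ℝ) :
    v ⬝ᵥ (Rᵀ * R) *ᵥ v = R *ᵥ v ⬝ᵥ R *ᵥ v := by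
  rw [← Matrix.mulVec_mulVec, Matrix.dotProduct_mulVec, Matrix.vecMul_transpose]

/-- The product of two Gaussian entries, each depending on a subfamily of the coordinates, is again
a Gaussian entry. -/
lemma exists_gEntry_mul_gEntry {ι ι' κ : Type*} [Fintype ι] [Fintype ι'] [Fintype κ]
    (e : ι → κ) (e' : ι' → κ) (C C' : ℝ) (m : ι → ℝ) (m' : ι' → ℝ)
    {P : Matrix ι ι ℝ} {P' : Matrix ι' ι' ℝ} (hP : P.PosSemidef) (hP' : P'.PosSemidef) :
    ∃ (C'' : ℝ) (m'' : κ → ℝ) (P'' : Matrix κ κ ℝ), P''.PosSemidef ∧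
      ∀ w : κ → ℝ, gEntry C'' m'' P'' w = gEntry C m P (w ∘ e) * gEntry C' m' P' (w ∘ e') := by
  classical
  obtain ⟨R, rfl⟩ := hP.exists_transpose_mul_self
  obtain ⟨R', rfl⟩ := hP'.exists_transpose_mul_self
  let E : Matrix ι κ ℝ := (1 : Matrix κ κ ℝ).submatrix e id
  let E' : Matrix ι' κ ℝ := (1 : Matrix κ κ ℝ).submatrix e' id
  have hE (w : κ → ℝ) : E *ᵥ w = w ∘ e := by
    ext i; simp [E, Matrix.mulVec, dotProduct, Matrix.one_apply]
  have hE' (w : κ → ℝ) : E' *ᵥ w = w ∘ e' := by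
    ext i; simp [E', Matrix.mulVec, dotProduct, Matrix.one_apply]
  obtain ⟨c, t, h⟩ := exists_sq_eq_quadForm_add_const
    (Matrix.fromRows (R * E) (R' * E')) (Sum.elim (R *ᵥ m) (R' *ᵥ m'))
  refine ⟨C + C' - t, c, _, Matrix.posSemidef_conjTranspose_mul_self
    (Matrix.fromRows (R * E) (R' * E')), fun w => ?_⟩
  have hw := h w
  have hsum : Matrix.fromRows (R * E) (R' * E') *ᵥ w - Sum.elim (R *ᵥ m) (R' *ᵥ m') =
      Sum.elim (R *ᵥ (w ∘ e - m)) (R' *ᵥ (w ∘ e' - m')) := by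
    rw [Matrix.fromRows_mulVec, ← Matrix.mulVec_mulVec, ← Matrix.mulVec_mulVec, hE, hE',
      Matrix.mulVec_sub, Matrix.mulVec_sub]
    ext (i | i) <;> rfl
  rw [hsum, sumElim_dotProduct_sumElim] at hw
  simp only [gEntry, ← Real.exp_add, dotProduct_transpose_mul_self_mulVec,
    Matrix.conjTranspose_eq_transpose_of_trivial] at hw ⊢
  congr 1
  linarith

/-- the product of a Generalized Gaussian PSD model of order `M1` on
`ℝ^{d1+d2}` with one of order `M2` on `ℝ^{d2+d3}` is a Generalized Gaussian PSD model
of order at most `M1 * M2` on `ℝ^{d1+d2+d3}`. -/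
theorem product_of_generalized_gaussian_psd_models
    (d1 d2 d3 M1 M2 : ℕ)
    -- the model f on ℝ^{d1+d2}
    (A : Matrix (Fin M1) (Fin M1) ℝ) (hA : A.PosSemidef)
    (C : Fin M1 → Fin M1 → ℝ)
    (m : Fin M1 → Fin M1 → (Fin d1 ⊕ Fin d2) → ℝ)
    (P : Fin M1 → Fin M1 → Matrix (Fin d1 ⊕ Fin d2) (Fin d1 ⊕ Fin d2) ℝ)
    (hP : ∀ i j, (P i j).PosSemidef)
    (hB : ∀ w : (Fin d1 ⊕ Fin d2) → ℝ,
      (Matrix.of fun i j => gEntry (C i j) (m i j) (P i j) w).PosSemidef)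
    (f : (Fin d1 → ℝ) → (Fin d2 → ℝ) → ℝ)
    (hf : ∀ x y, f x y = ∑ i, ∑ j, A i j * gEntry (C i j) (m i j) (P i j) (Sum.elim x y))
    -- the model g on ℝ^{d2+d3}
    (A' : Matrix (Fin M2) (Fin M2) ℝ) (hA' : A'.PosSemidef)
    (C' : Fin M2 → Fin M2 → ℝ)
    (m' : Fin M2 → Fin M2 → (Fin d2 ⊕ Fin d3) → ℝ)
    (P' : Fin M2 → Fin M2 → Matrix (Fin d2 ⊕ Fin d3) (Fin d2 ⊕ Fin d3) ℝ)
    (hP' : ∀ k l, (P' k l).PosSemidef)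
    (hB' : ∀ w : (Fin d2 ⊕ Fin d3) → ℝ,
      (Matrix.of fun k l => gEntry (C' k l) (m' k l) (P' k l) w).PosSemidef)
    (g : (Fin d2 → ℝ) → (Fin d3 → ℝ) → ℝ)
    (hg : ∀ y z, g y z =
      ∑ k, ∑ l, A' k l * gEntry (C' k l) (m' k l) (P' k l) (Sum.elim y z)) :
    ∃ (A'' : Matrix (Fin (M1 * M2)) (Fin (M1 * M2)) ℝ)
      (C'' : Fin (M1 * M2) → Fin (M1 * M2) → ℝ)
      (m'' : Fin (M1 * M2) → Fin (M1 * M2) → (Fin d1 ⊕ (Fin d2 ⊕ Fin d3)) → ℝ)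
      (P'' : Fin (M1 * M2) → Fin (M1 * M2) →
        Matrix (Fin d1 ⊕ (Fin d2 ⊕ Fin d3)) (Fin d1 ⊕ (Fin d2 ⊕ Fin d3)) ℝ),
      A''.PosSemidef ∧ (∀ k l, (P'' k l).PosSemidef) ∧
      (∀ w : (Fin d1 ⊕ (Fin d2 ⊕ Fin d3)) → ℝ,
        (Matrix.of fun k l => gEntry (C'' k l) (m'' k l) (P'' k l) w).PosSemidef) ∧
      ∀ x y z, f x y * g y z = ∑ k, ∑ l, A'' k l *
        gEntry (C'' k l) (m'' k l) (P'' k l) (Sum.elim x (Sum.elim y z)) := by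
  let e : Fin d1 ⊕ Fin d2 → Fin d1 ⊕ (Fin d2 ⊕ Fin d3) := Sum.map id Sum.inl
  let e' : Fin d2 ⊕ Fin d3 → Fin d1 ⊕ (Fin d2 ⊕ Fin d3) := Sum.inr
  let s : Fin (M1 * M2) ≃ Fin M1 × Fin M2 := finProdFinEquiv.symm
  choose C'' m'' P'' hP'' hmul using fun p q : Fin (M1 * M2) =>
    exists_gEntry_mul_gEntry e e' (C (s p).1 (s q).1) (C' (s p).2 (s q).2)
      (m (s p).1 (s q).1) (m' (s p).2 (s q).2)
      (hP (s p).1 (s q).1) (hP' (s p).2 (s q).2)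
  refine ⟨(Matrix.kroneckerMap (· * ·) A A').submatrix s s, C'', m'', P'',
    (hA.kronecker hA').submatrix s, hP'', fun w => ?_, fun x y z => ?_⟩
  · simp only [hmul]
    exact ((hB (w ∘ e)).kronecker (hB' (w ∘ e'))).submatrix s
  · have he : Sum.elim x (Sum.elim y z) ∘ e = Sum.elim x y := by
      ext (i | i) <;> rfl
    have he' : Sum.elim x (Sum.elim y z) ∘ e' = Sum.elim y z := by
      ext (i | i) <;> rfl
    simp only [hmul, he, he', hf, hg, Matrix.submatrix_apply, Matrix.kroneckerMap_apply]
    rw [← s.symm.sum_comp, Fintype.sum_prod_type]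
    simp_rw [← s.symm.sum_comp, Fintype.sum_prod_type, Equiv.apply_symm_apply,
      Finset.sum_mul_sum]
    refine Finset.sum_congr rfl fun i _ => Finset.sum_congr rfl fun k _ => ?_
    refine Finset.sum_congr rfl fun j _ => Finset.sum_congr rfl fun l _ => ?_
    ring
end
end

section
/- Let f(x,y) = Σ_{i,j=1}^{M} A_{ij} exp(C_{ij}) exp(−(w − w_{ij})ᵀ P_{ij} (w − w_{ij})) (with w = (x,y) ∈ ℝ^{d1+d2}) be a Generalized Gaussian PSD model of order M in which every precision matrix P_{ij} is positive definite. Then h(x) = ∫_{ℝ^{d2}} f(x,y) dy is a Generalized Gaussian PSD model of order at most M on ℝ^{d1}: there exist a positive semidefinite weight matrix, constants, centers in ℝ^{d1} and positive semidefinite d1×d1 precision matrices representing h in the same form with the associated matrix B'(x) positive semidefinite for every x; in particular B'(x) = ∫_{ℝ^{d2}} B(x,y) dy entrywise. -/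
open MeasureTheory Matrix
open scoped BigOperators Matrix

noncomputable section

theorem Matrix.PosDef.exists_det_ne_zero_eq_transpose_mul_self {n : Type*} [Fintype n]
    [DecidableEq n] {D : Matrix n n ℝ} (hD : D.PosDef) :
    ∃ L : Matrix n n ℝ, L.det ≠ 0 ∧ D = Lᵀ * L := by
  open scoped MatrixOrder in
  obtain ⟨L, hL⟩ := CStarAlgebra.nonneg_iff_eq_star_mul_self.mp hD.posSemidef.nonneg
  rw [star_eq_conjTranspose, conjTranspose_eq_transpose_of_trivial] at hL
  refine ⟨L, fun h => hD.det_pos.ne' ?_, hL⟩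
  rw [hL, det_mul, h, mul_zero]

theorem integrable_exp_neg_dotProduct_self {n : Type*} [Fintype n] :
    Integrable fun v : n → ℝ => Real.exp (-(v ⬝ᵥ v)) := by
  have h : Integrable (fun v : n → ℝ => ∏ i, Real.exp (-1 * v i ^ 2)) :=
    Integrable.fintype_prod (f := fun _ t => Real.exp (-1 * t ^ 2))
      fun _ => integrable_exp_neg_mul_sq one_pos
  refine h.congr (.of_forall fun v => ?_)
  simp [← Real.exp_sum, dotProduct, sq]

theorem Matrix.PosDef.integrable_exp_neg {n : Type*} [Fintype n] {D : Matrix n n ℝ}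
    (hD : D.PosDef) : Integrable fun v : n → ℝ => Real.exp (-(v ⬝ᵥ D.mulVec v)) := by
  classical
  obtain ⟨L, hL, rfl⟩ := hD.exists_det_ne_zero_eq_transpose_mul_self
  have hmap : Integrable (fun v : n → ℝ => Real.exp (-(v ⬝ᵥ v)))
      (Measure.map (toLin' L) volume) := by
    rw [Real.map_matrix_volume_pi_eq_smul_volume_pi hL]
    exact integrable_exp_neg_dotProduct_self.smul_measure ENNReal.ofReal_ne_top
  refine (hmap.comp_measurable
    (LinearMap.continuous_of_finiteDimensional (toLin' L)).measurable).congr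
    (.of_forall fun v => ?_)
  simp only [Function.comp_apply, toLin'_apply]
  rw [← mulVec_mulVec, dotProduct_mulVec v, vecMul_transpose]

/-- Completing the square in the second block of variables. -/
theorem Matrix.PosDef.exists_complete_square {p q : Type*} [Fintype p] [Fintype q]
    {P : Matrix (p ⊕ q) (p ⊕ q) ℝ} (hP : P.PosDef) :
    ∃ (S : Matrix p p ℝ) (D : Matrix q q ℝ) (T : Matrix q p ℝ), S.PosSemidef ∧ D.PosDef ∧
      ∀ u v, Sum.elim u v ⬝ᵥ P.mulVec (Sum.elim u v) =
        u ⬝ᵥ S.mulVec u + (T.mulVec u + v) ⬝ᵥ D.mulVec (T.mulVec u + v) := by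
  classical
  have hD : P.toBlocks₂₂.PosDef := hP.submatrix Sum.inr_injective
  have := hD.isUnit.invertible
  have hblocks : fromBlocks P.toBlocks₁₁ P.toBlocks₁₂ P.toBlocks₁₂ᴴ P.toBlocks₂₂ = P := by
    conv_rhs => rw [← fromBlocks_toBlocks P]
    congr 1
    ext i j
    exact hP.isHermitian.apply (Sum.inr i) (Sum.inl j)
  refine ⟨P.toBlocks₁₁ - P.toBlocks₁₂ * P.toBlocks₂₂⁻¹ * P.toBlocks₁₂ᴴ, P.toBlocks₂₂,
    P.toBlocks₂₂⁻¹ * P.toBlocks₁₂ᴴ, ?_, hD, fun u v => ?_⟩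
  · rw [← PosDef.fromBlocks₂₂ _ _ hD, hblocks]
    exact hP.posSemidef
  · have h := schur_complement_eq₂₂ P.toBlocks₁₁ P.toBlocks₁₂ u v hD.isHermitian
    rw [hblocks] at h
    simp only [star_trivial, ← dotProduct_mulVec] at h
    rw [h, add_comm]

theorem exists_gEntry_eq_integral {p q : Type*} [Fintype p] [Fintype q] (C : ℝ)
    (m : p ⊕ q → ℝ) {P : Matrix (p ⊕ q) (p ⊕ q) ℝ} (hP : P.PosDef) :
    ∃ (C' : ℝ) (m' : p → ℝ) (P' : Matrix p p ℝ), P'.PosSemidef ∧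
      ∀ x : p → ℝ, Integrable (fun y : q → ℝ => gEntry C m P (Sum.elim x y)) ∧
        gEntry C' m' P' x = ∫ y : q → ℝ, gEntry C m P (Sum.elim x y) := by
  obtain ⟨S, D, T, hS, hD, h⟩ := hP.exists_complete_square
  have hint := hD.integrable_exp_neg
  have hpos := integral_exp_pos hint
  refine ⟨C + Real.log (∫ v : q → ℝ, Real.exp (-(v ⬝ᵥ D.mulVec v))), m ∘ Sum.inl, S, hS,
    fun x => ?_⟩
  have key : (fun y : q → ℝ => gEntry C m P (Sum.elim x y)) = fun y =>
      gEntry C (m ∘ Sum.inl) S x *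
        (fun v => Real.exp (-(v ⬝ᵥ D.mulVec v)))
          (y + (T.mulVec (x - m ∘ Sum.inl) - m ∘ Sum.inr)) := by
    funext y
    have hsub : Sum.elim x y - m = Sum.elim (x - m ∘ Sum.inl) (y - m ∘ Sum.inr) := by
      ext (i | i) <;> rfl
    have hshift : T.mulVec (x - m ∘ Sum.inl) + (y - m ∘ Sum.inr) =
        y + (T.mulVec (x - m ∘ Sum.inl) - m ∘ Sum.inr) := by abel
    simp only [gEntry]
    rw [hsub, h, neg_add, Real.exp_add, hshift, mul_assoc]
  rw [key]
  refine ⟨(hint.comp_add_right _).const_mul _, ?_⟩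
  rw [integral_const_mul, integral_add_right_eq_self
    (fun v : q → ℝ => Real.exp (-(v ⬝ᵥ D.mulVec v)))]
  simp only [gEntry]
  rw [Real.exp_add, Real.exp_log hpos]
  ring

theorem Matrix.PosSemidef.integral {α n : Type*} [Fintype n] [MeasurableSpace α]
    {μ : Measure α} {B : α → Matrix n n ℝ} (hB : ∀ a, (B a).PosSemidef)
    (hint : ∀ i j, Integrable (fun a => B a i j) μ) :
    (Matrix.of fun i j => ∫ a, B a i j ∂μ).PosSemidef := by
  refine .of_dotProduct_mulVec_nonneg ?_ fun v => ?_
  · ext i j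
    exact integral_congr_ae (.of_forall fun a => (hB a).isHermitian.apply i j)
  · have h : star v ⬝ᵥ (Matrix.of fun i j => ∫ a, B a i j ∂μ).mulVec v =
        ∫ a, star v ⬝ᵥ (B a).mulVec v ∂μ := by
      simp only [dotProduct, mulVec, of_apply]
      rw [integral_finsetSum _ fun i _ => (integrable_finsetSum _ fun j _ =>
        (hint i j).mul_const _).const_mul _]
      refine Finset.sum_congr rfl fun i _ => ?_
      rw [integral_const_mul, integral_finsetSum _ fun j _ => (hint i j).mul_const _]
      simp only [integral_mul_const]
    rw [h]
    exact integral_nonneg fun a => (hB a).dotProduct_mulVec_nonneg v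

/-- the marginal over `y` of a Generalized Gaussian PSD model of order `M`
on `ℝ^{d1+d2}` with positive definite precision matrices is a Generalized Gaussian PSD
model of order at most `M` on `ℝ^{d1}`, whose matrix `B'(x)` is the entrywise integral
`∫ B(x,y) dy` and is positive semidefinite for every `x`. -/
theorem marginal_of_generalized_gaussian_psd_model
    (d1 d2 M : ℕ)
    (A : Matrix (Fin M) (Fin M) ℝ) (hA : A.PosSemidef)
    (C : Fin M → Fin M → ℝ)
    (m : Fin M → Fin M → (Fin d1 ⊕ Fin d2) → ℝ)
    (P : Fin M → Fin M → Matrix (Fin d1 ⊕ Fin d2) (Fin d1 ⊕ Fin d2) ℝ)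
    (hP : ∀ i j, (P i j).PosDef)
    (hB : ∀ w : (Fin d1 ⊕ Fin d2) → ℝ,
      (Matrix.of fun i j => gEntry (C i j) (m i j) (P i j) w).PosSemidef)
    (f : (Fin d1 → ℝ) → (Fin d2 → ℝ) → ℝ)
    (hf : ∀ x y, f x y =
      ∑ i, ∑ j, A i j * gEntry (C i j) (m i j) (P i j) (Sum.elim x y)) :
    ∃ (A' : Matrix (Fin M) (Fin M) ℝ)
      (C' : Fin M → Fin M → ℝ)
      (m' : Fin M → Fin M → Fin d1 → ℝ)
      (P' : Fin M → Fin M → Matrix (Fin d1) (Fin d1) ℝ),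
      A'.PosSemidef ∧ (∀ i j, (P' i j).PosSemidef) ∧
      (∀ x : Fin d1 → ℝ,
        (Matrix.of fun i j => gEntry (C' i j) (m' i j) (P' i j) x).PosSemidef) ∧
      (∀ (x : Fin d1 → ℝ) (i j : Fin M),
        gEntry (C' i j) (m' i j) (P' i j) x =
          ∫ y : Fin d2 → ℝ, gEntry (C i j) (m i j) (P i j) (Sum.elim x y)) ∧
      ∀ x : Fin d1 → ℝ, (∫ y : Fin d2 → ℝ, f x y) =
        ∑ i, ∑ j, A' i j * gEntry (C' i j) (m' i j) (P' i j) x := by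
  choose C' m' P' hP' hgEntry using fun i j => exists_gEntry_eq_integral (C i j) (m i j) (hP i j)
  refine ⟨A, C', m', P', hA, hP', fun x => ?_, fun x i j => (hgEntry i j x).2, fun x => ?_⟩
  · simp only [fun i j => (hgEntry i j x).2]
    exact PosSemidef.integral (fun y => hB (Sum.elim x y)) fun i j => (hgEntry i j x).1
  · have hint (i j : Fin M) : Integrable fun y : Fin d2 → ℝ =>
        A i j * gEntry (C i j) (m i j) (P i j) (Sum.elim x y) :=
      (hgEntry i j x).1.const_mul _
    simp only [hf, fun i j => (hgEntry i j x).2]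
    refine (integral_finsetSum _ fun i _ => integrable_finsetSum _ fun j _ => hint i j).trans
      (Finset.sum_congr rfl fun i _ => ?_)
    exact (integral_finsetSum _ fun j _ => hint i j).trans
      (Finset.sum_congr rfl fun j _ => integral_const_mul _ _)
end
end

section
/- Let f(x,y) = Σ_{i,j=1}^{M} A_{ij} exp(C_{ij}) exp(−(w − w_{ij})ᵀ P_{ij} (w − w_{ij})) (with w = (x,y) ∈ ℝ^{d1+d2}) be a Generalized Gaussian PSD model of order M, and let y_0 ∈ ℝ^{d2} be fixed. Then the partial evaluation h(x) = f(x, y_0) is a Generalized Gaussian PSD model of order at most M on ℝ^{d1}: there exist a positive semidefinite weight matrix, constants, centers in ℝ^{d1} and positive semidefinite d1×d1 precision matrices representing h in the same form, with the matrix B'(x) = B(x, y_0) positive semidefinite for every x. -/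
open MeasureTheory Matrix
open scoped BigOperators Matrix

noncomputable section

theorem Matrix.dotProduct_transpose_mul_self_mulVec {R k n : Type*} [CommSemiring R] [Fintype k]
    [Fintype n] (B : Matrix k n R) (a : n → R) :
    a ⬝ᵥ (Bᵀ * B) *ᵥ a = B *ᵥ a ⬝ᵥ B *ᵥ a := by
  rw [← Matrix.mulVec_mulVec, Matrix.dotProduct_mulVec, Matrix.vecMul_transpose]

theorem Matrix.exists_transpose_mul_self_mulVec_eq {k n : Type*} [Fintype k] [Fintype n]
    (B : Matrix k n ℝ) (w : k → ℝ) : ∃ z, Bᵀ *ᵥ (B *ᵥ z) = Bᵀ *ᵥ w := by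
  have hle : LinearMap.range (Bᵀ * B).mulVecLin ≤ LinearMap.range Bᵀ.mulVecLin := by
    rw [Matrix.mulVecLin_mul]
    exact LinearMap.range_comp_le_range _ _
  have heq := Submodule.eq_of_le_of_finrank_eq hle
    ((Matrix.rank_transpose_mul_self B).trans (Matrix.rank_transpose B).symm)
  obtain ⟨z, hz⟩ := heq.ge (LinearMap.mem_range_self Bᵀ.mulVecLin w)
  exact ⟨z, (Matrix.mulVec_mulVec z Bᵀ B).trans hz⟩

/-- Restricting a positive semidefinite quadratic form to an affine slice `y = v` and completing
the square. -/
theorem Matrix.PosSemidef.exists_completed_square_slice {ι κ : Type*} [Fintype ι] [Fintype κ]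
    {P : Matrix (ι ⊕ κ) (ι ⊕ κ) ℝ} (hP : P.PosSemidef) (v : κ → ℝ) :
    ∃ (z : ι → ℝ) (c : ℝ), ∀ u : ι → ℝ,
      Sum.elim u v ⬝ᵥ P *ᵥ Sum.elim u v = (u + z) ⬝ᵥ P.toBlocks₁₁ *ᵥ (u + z) + c := by
  classical
  open scoped MatrixOrder Matrix.Norms.L2Operator in
  obtain ⟨B, rfl⟩ := CStarAlgebra.nonneg_iff_eq_star_mul_self.mp hP.nonneg
  obtain ⟨z, hz⟩ := B.toCols₁.exists_transpose_mul_self_mulVec_eq (B.toCols₂ *ᵥ v)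
  set r := B.toCols₂ *ᵥ v - B.toCols₁ *ᵥ z with hr
  have hr0 : B.toCols₁ᵀ *ᵥ r = 0 := by rw [hr, Matrix.mulVec_sub, hz, sub_self]
  have hblock : (star B * B).toBlocks₁₁ = B.toCols₁ᵀ * B.toCols₁ := rfl
  refine ⟨z, r ⬝ᵥ r, fun u => ?_⟩
  have hsplit : B *ᵥ Sum.elim u v = B.toCols₁ *ᵥ (u + z) + r := by
    conv_lhs => rw [← Matrix.fromCols_toCols B, Matrix.fromCols_mulVec_sumElim]
    rw [hr, Matrix.mulVec_add]
    abel
  have horth : B.toCols₁ *ᵥ (u + z) ⬝ᵥ r = 0 := by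
    rw [← Matrix.vecMul_transpose, ← Matrix.dotProduct_mulVec, hr0, dotProduct_zero]
  rw [hblock, Matrix.star_eq_conjTranspose, Matrix.conjTranspose_eq_transpose_of_trivial,
    Matrix.dotProduct_transpose_mul_self_mulVec, Matrix.dotProduct_transpose_mul_self_mulVec, hsplit,
    add_dotProduct, dotProduct_add, dotProduct_add, horth, dotProduct_comm r, horth]
  ring

theorem exists_gEntry_eq_sumElim {ι κ : Type*} [Fintype ι] [Fintype κ] (C : ℝ)
    (m : ι ⊕ κ → ℝ) {P : Matrix (ι ⊕ κ) (ι ⊕ κ) ℝ} (hP : P.PosSemidef) (y : κ → ℝ) :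
    ∃ (C' : ℝ) (m' : ι → ℝ), ∀ x : ι → ℝ,
      gEntry C' m' P.toBlocks₁₁ x = gEntry C m P (Sum.elim x y) := by
  obtain ⟨z, c, h⟩ := hP.exists_completed_square_slice (y - m ∘ Sum.inr)
  refine ⟨C - c, m ∘ Sum.inl - z, fun x => ?_⟩
  have hw : Sum.elim x y - m = Sum.elim (x - m ∘ Sum.inl) (y - m ∘ Sum.inr) := by
    ext (i | i) <;> rfl
  have hx : x - (m ∘ Sum.inl - z) = x - m ∘ Sum.inl + z := by abel
  rw [gEntry, gEntry, hw, h, hx, ← Real.exp_add, ← Real.exp_add]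
  congr 1
  ring

/-- the partial evaluation at `y = y₀` of a Generalized Gaussian PSD model
of order `M` on `ℝ^{d1+d2}` is a Generalized Gaussian PSD model of order at most `M` on
`ℝ^{d1}`, whose matrix `B'(x) = B(x,y₀)` is positive semidefinite for every `x`. -/
theorem partial_evaluation_of_generalized_gaussian_psd_model
    (d1 d2 M : ℕ)
    (A : Matrix (Fin M) (Fin M) ℝ) (hA : A.PosSemidef)
    (C : Fin M → Fin M → ℝ)
    (m : Fin M → Fin M → (Fin d1 ⊕ Fin d2) → ℝ)
    (P : Fin M → Fin M → Matrix (Fin d1 ⊕ Fin d2) (Fin d1 ⊕ Fin d2) ℝ)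
    (hP : ∀ i j, (P i j).PosSemidef)
    (hB : ∀ w : (Fin d1 ⊕ Fin d2) → ℝ,
      (Matrix.of fun i j => gEntry (C i j) (m i j) (P i j) w).PosSemidef)
    (f : (Fin d1 → ℝ) → (Fin d2 → ℝ) → ℝ)
    (hf : ∀ x y, f x y =
      ∑ i, ∑ j, A i j * gEntry (C i j) (m i j) (P i j) (Sum.elim x y))
    (y0 : Fin d2 → ℝ) :
    ∃ (A' : Matrix (Fin M) (Fin M) ℝ)
      (C' : Fin M → Fin M → ℝ)
      (m' : Fin M → Fin M → Fin d1 → ℝ)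
      (P' : Fin M → Fin M → Matrix (Fin d1) (Fin d1) ℝ),
      A'.PosSemidef ∧ (∀ i j, (P' i j).PosSemidef) ∧
      (∀ x : Fin d1 → ℝ,
        (Matrix.of fun i j => gEntry (C' i j) (m' i j) (P' i j) x).PosSemidef) ∧
      (∀ (x : Fin d1 → ℝ) (i j : Fin M),
        gEntry (C' i j) (m' i j) (P' i j) x =
          gEntry (C i j) (m i j) (P i j) (Sum.elim x y0)) ∧
      ∀ x : Fin d1 → ℝ, f x y0 =
        ∑ i, ∑ j, A' i j * gEntry (C' i j) (m' i j) (P' i j) x := by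
  choose C' m' h using fun i j => exists_gEntry_eq_sumElim (C i j) (m i j) (hP i j) y0
  refine ⟨A, C', m', fun i j => (P i j).toBlocks₁₁, hA,
    fun i j => (hP i j).submatrix Sum.inl, fun x => ?_, fun x i j => h i j x, fun x => ?_⟩
  · simpa only [h] using hB (Sum.elim x y0)
  · simp only [h, hf]
end
end

section
/- Let μ(x), q(u,x) and g(x,y) be Generalized Gaussian PSD models of orders M, M_q and M_g on ℝ^d, ℝ^{2d} and ℝ^{d+d'} respectively, in which all precision matrices are positive definite. Let y ∈ ℝ^{d'} be such that Z = ∫_{ℝ^d} ∫_{ℝ^d} q(u,x) g(x,y) μ(u) du dx > 0. Then the density μ'(x) = (∫_{ℝ^d} q(u,x) g(x,y) μ(u) du) / Z is a Generalized Gaussian PSD model of order at most M · M_q · M_g on ℝ^d. -/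
open MeasureTheory Matrix
open scoped BigOperators Matrix

noncomputable section

/-- `f` is a Generalized Gaussian PSD model of order (at most) `N` on `ℝ^ι`. -/
def IsGenGaussianPSD {ι : Type*} [Fintype ι] (N : ℕ) (f : (ι → ℝ) → ℝ) : Prop :=
  ∃ (A : Matrix (Fin N) (Fin N) ℝ) (C : Fin N → Fin N → ℝ)
    (m : Fin N → Fin N → ι → ℝ) (P : Fin N → Fin N → Matrix ι ι ℝ),
    A.PosSemidef ∧ (∀ i j, (P i j).PosSemidef) ∧
    (∀ w : ι → ℝ, (Matrix.of fun i j => gEntry (C i j) (m i j) (P i j) w).PosSemidef) ∧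
    ∀ w, f w = ∑ i, ∑ j, A i j * gEntry (C i j) (m i j) (P i j) w

/-- The quadratic form of a symmetric matrix is symmetric. -/
theorem dotProduct_mulVec_comm_of_isHermitian {ι : Type*} [Fintype ι] {P : Matrix ι ι ℝ}
    (hP : P.IsHermitian) (v w : ι → ℝ) : v ⬝ᵥ P *ᵥ w = w ⬝ᵥ P *ᵥ v := by
  have h : Pᵀ = P := by rw [← conjTranspose_eq_transpose_of_trivial, hP.eq]
  rw [dotProduct_mulVec, ← mulVec_transpose, h, dotProduct_comm]

/-- A positive definite quadratic form dominates a positive multiple of the sum of squares. -/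
theorem exists_pos_mul_sum_sq_le {ι : Type*} [Fintype ι] {P : Matrix ι ι ℝ} (hP : P.PosDef) :
    ∃ c : ℝ, 0 < c ∧ ∀ u : ι → ℝ, c * ∑ i, u i ^ 2 ≤ u ⬝ᵥ P *ᵥ u := by
  have hcont : Continuous fun u : ι → ℝ => u ⬝ᵥ P *ᵥ u := by
    simp only [dotProduct, mulVec]
    fun_prop
  have hlow : ∃ c : ℝ, 0 < c ∧ ∀ u : ι → ℝ, c * ‖u‖ ^ 2 ≤ u ⬝ᵥ P *ᵥ u := by
    have key : ∃ c : ℝ, 0 < c ∧ ∀ u ∈ Metric.sphere (0 : ι → ℝ) 1, c ≤ u ⬝ᵥ P *ᵥ u := by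
      rcases (Metric.sphere (0 : ι → ℝ) 1).eq_empty_or_nonempty with he | hne
      · exact ⟨1, one_pos, by simp [he]⟩
      · obtain ⟨v, hv, hmin⟩ := (isCompact_sphere (0 : ι → ℝ) 1).exists_isMinOn hne
          hcont.continuousOn
        have hv0 : v ≠ 0 := by
          rintro rfl
          simp at hv
        exact ⟨_, by simpa using hP.dotProduct_mulVec_pos hv0, fun u hu => hmin hu⟩
    obtain ⟨c, hc, hmin⟩ := key
    refine ⟨c, hc, fun u => ?_⟩
    rcases eq_or_ne u 0 with rfl | hu
    · simp
    · have hn : 0 < ‖u‖ := norm_pos_iff.mpr hu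
      have h := hmin (‖u‖⁻¹ • u) (by simp [norm_smul, hn.ne'])
      rw [mulVec_smul, dotProduct_smul, smul_dotProduct, smul_eq_mul, smul_eq_mul] at h
      calc c * ‖u‖ ^ 2 ≤ (‖u‖⁻¹ * (‖u‖⁻¹ * (u ⬝ᵥ P *ᵥ u))) * ‖u‖ ^ 2 := by gcongr
        _ = u ⬝ᵥ P *ᵥ u := by field_simp
  obtain ⟨c, hc, h⟩ := hlow
  refine ⟨c / (Fintype.card ι + 1), by positivity, fun u => le_trans ?_ (h u)⟩
  have hs : ∑ i, u i ^ 2 ≤ (Fintype.card ι + 1) * ‖u‖ ^ 2 := by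
    calc ∑ i, u i ^ 2 ≤ ∑ _i : ι, ‖u‖ ^ 2 := by
          refine Finset.sum_le_sum fun i _ => ?_
          rw [← sq_abs]
          gcongr
          exact norm_le_pi_norm u i
      _ = Fintype.card ι * ‖u‖ ^ 2 := by simp
      _ ≤ _ := by gcongr; linarith
  calc c / (Fintype.card ι + 1) * ∑ i, u i ^ 2
      ≤ c / (Fintype.card ι + 1) * ((Fintype.card ι + 1) * ‖u‖ ^ 2) := by gcongr
    _ = c * ‖u‖ ^ 2 := by field_simp

theorem gEntry_pos {ι : Type*} [Fintype ι] (C : ℝ) (m : ι → ℝ) (P : Matrix ι ι ℝ) (w : ι → ℝ) :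
    0 < gEntry C m P w := by
  unfold gEntry
  positivity

theorem gEntry_sub {ι : Type*} [Fintype ι] (C : ℝ) (m : ι → ℝ) (P : Matrix ι ι ℝ) (w : ι → ℝ) :
    gEntry C m P w = gEntry C 0 P (w - m) := by
  simp [gEntry]

theorem continuous_gEntry {ι : Type*} [Fintype ι] (C : ℝ) (m : ι → ℝ) (P : Matrix ι ι ℝ) :
    Continuous (gEntry C m P) := by
  unfold gEntry
  simp only [dotProduct, mulVec]
  fun_prop

/-- Multiplying a Gaussian entry by a positive constant changes only its log-weight. -/
theorem mul_gEntry {ι : Type*} [Fintype ι] {K : ℝ} (hK : 0 < K) (C : ℝ) (m : ι → ℝ)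
    (P : Matrix ι ι ℝ) (w : ι → ℝ) : K * gEntry C m P w = gEntry (Real.log K + C) m P w := by
  rw [gEntry, gEntry, Real.exp_add, Real.exp_log hK, mul_assoc]

theorem integrable_gEntry {ι : Type*} [Fintype ι] (C : ℝ) (m : ι → ℝ) {P : Matrix ι ι ℝ}
    (hP : P.PosDef) : Integrable (gEntry C m P) := by
  have h0 : Integrable (gEntry C 0 P) := by
    obtain ⟨c, hc, h⟩ := exists_pos_mul_sum_sq_le hP
    have hi : Integrable fun v : ι → ℝ => Real.exp (-c * ∑ i, v i ^ 2) := by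
      have := (GaussianFourier.integrable_cexp_neg_mul_sum_add (b := (c : ℂ)) (by simpa using hc)
        (0 : ι → ℂ)).re
      refine this.congr (Filter.Eventually.of_forall fun v => ?_)
      simp only [Pi.zero_apply, zero_mul, Finset.sum_const_zero, add_zero]
      have e : (-(c : ℂ) * ∑ i, (v i : ℂ) ^ 2) = ((-c * ∑ i, v i ^ 2 : ℝ) : ℂ) := by
        push_cast
        rfl
      rw [e, ← Complex.ofReal_exp]
      exact Complex.ofReal_re _
    refine (hi.const_mul (Real.exp C)).mono' (continuous_gEntry C 0 P).aestronglyMeasurable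
      (Filter.Eventually.of_forall fun v => ?_)
    rw [Real.norm_of_nonneg (gEntry_pos C 0 P v).le, gEntry]
    gcongr
    have := h v
    simp only [sub_zero]
    linarith
  have := h0.comp_sub_right m
  exact this.congr (Filter.Eventually.of_forall fun v => (gEntry_sub C m P v).symm)

theorem integral_gEntry_pos {ι : Type*} [Fintype ι] (C : ℝ) (m : ι → ℝ) {P : Matrix ι ι ℝ}
    (hP : P.PosDef) : 0 < ∫ w, gEntry C m P w :=
  integral_pos_of_integrable_nonneg_nonzero (x := 0) (continuous_gEntry C m P)
    (integrable_gEntry C m hP) (fun w => (gEntry_pos C m P w).le) (gEntry_pos C m P 0).ne'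

/-- The product of two Gaussian entries is a Gaussian entry, by completing the square. -/
theorem exists_gEntry_mul_gEntry_s11 {ι : Type*} [Fintype ι] (C₁ C₂ : ℝ) (m₁ m₂ : ι → ℝ)
    {P₁ P₂ : Matrix ι ι ℝ} (h₁ : P₁.PosDef) (h₂ : P₂.PosSemidef) :
    ∃ C m, ∀ w, gEntry C₁ m₁ P₁ w * gEntry C₂ m₂ P₂ w = gEntry C m (P₁ + P₂) w := by
  classical
  have hS : (P₁ + P₂).PosDef := h₁.add_posSemidef h₂
  set m := (P₁ + P₂)⁻¹ *ᵥ (P₁ *ᵥ m₁ + P₂ *ᵥ m₂) with hm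
  have hSm : P₁ *ᵥ m + P₂ *ᵥ m = P₁ *ᵥ m₁ + P₂ *ᵥ m₂ := by
    rw [← add_mulVec, hm, mulVec_mulVec, mul_nonsing_inv _ ((isUnit_iff_isUnit_det _).1 hS.isUnit),
      one_mulVec]
  refine ⟨C₁ + C₂ - (m - m₁) ⬝ᵥ P₁ *ᵥ (m - m₁) - (m - m₂) ⬝ᵥ P₂ *ᵥ (m - m₂), m, fun w => ?_⟩
  simp only [gEntry, ← Real.exp_add]
  congr 1
  have e := congrArg (fun v => w ⬝ᵥ v) hSm
  have e' := congrArg (fun v => m ⬝ᵥ v) hSm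
  simp only [dotProduct_add] at e e'
  simp only [mulVec_sub, sub_dotProduct, dotProduct_sub, add_mulVec, dotProduct_add]
  rw [dotProduct_mulVec_comm_of_isHermitian h₁.1 m₁ w,
    dotProduct_mulVec_comm_of_isHermitian h₂.1 m₂ w,
    dotProduct_mulVec_comm_of_isHermitian h₁.1 m₁ m,
    dotProduct_mulVec_comm_of_isHermitian h₂.1 m₂ m,
    dotProduct_mulVec_comm_of_isHermitian h₁.1 m w,
    dotProduct_mulVec_comm_of_isHermitian h₂.1 m w]
  linarith

/-- A Gaussian entry on a product space factors into a Gaussian in the first variable, with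
center affine in the second one, and a Gaussian in the second variable (Schur complement). -/
theorem exists_gEntry_sumElim_eq {ι κ : Type*} [Fintype ι] [Fintype κ] (C : ℝ)
    (m : ι ⊕ κ → ℝ) {P : Matrix (ι ⊕ κ) (ι ⊕ κ) ℝ} (hP : P.PosDef) :
    ∃ (c : (κ → ℝ) → ι → ℝ) (A : Matrix ι ι ℝ) (n : κ → ℝ) (S : Matrix κ κ ℝ),
      A.PosDef ∧ S.PosSemidef ∧
      ∀ u x, gEntry C m P (Sum.elim u x) = gEntry 0 (c x) A u * gEntry C n S x := by
  classical
  set A := P.toBlocks₁₁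
  set B := P.toBlocks₁₂
  set D := P.toBlocks₂₂
  have hA : A.PosDef := hP.submatrix Sum.inl_injective
  have hB : P.toBlocks₂₁ = Bᴴ := by
    ext i j
    exact (hP.1.apply (Sum.inr i) (Sum.inl j)).symm
  have hPb : P = fromBlocks A B Bᴴ D := by rw [← hB, fromBlocks_toBlocks]
  have : Invertible A := hA.isUnit.invertible
  refine ⟨fun x => m ∘ Sum.inl - (A⁻¹ * B) *ᵥ (x - m ∘ Sum.inr), A, m ∘ Sum.inr,
    D - Bᴴ * A⁻¹ * B, hA, (PosDef.fromBlocks₁₁ B D hA).1 (hPb ▸ hP.posSemidef),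
    fun u x => ?_⟩
  have hw : Sum.elim u x - m = Sum.elim (u - m ∘ Sum.inl) (x - m ∘ Sum.inr) := by
    ext (i | i) <;> rfl
  have h := schur_complement_eq₁₁ B D (u - m ∘ Sum.inl) (x - m ∘ Sum.inr) hA.1
  simp only [star_trivial, ← dotProduct_mulVec] at h
  have hc : u - (m ∘ Sum.inl - (A⁻¹ * B) *ᵥ (x - m ∘ Sum.inr)) =
      u - m ∘ Sum.inl + (A⁻¹ * B) *ᵥ (x - m ∘ Sum.inr) := by abel
  simp only [gEntry, ← Real.exp_add]
  rw [hw, hc, hPb, h]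
  congr 1
  ring

theorem gEntry_fromBlocks_zero {ι κ : Type*} [Fintype ι] [Fintype κ] (C : ℝ)
    (m : ι → ℝ) (P : Matrix ι ι ℝ) (u : ι → ℝ) (x : κ → ℝ) :
    gEntry C (Sum.elim m 0) (fromBlocks P 0 0 0) (Sum.elim u x) = gEntry C m P u := by
  have hw : Sum.elim u x - Sum.elim m 0 = Sum.elim (u - m) x := by
    ext (i | i) <;> simp
  simp [gEntry, hw, fromBlocks_mulVec, sumElim_dotProduct_sumElim]

theorem gEntry_fromBlocks_zero' {ι κ : Type*} [Fintype ι] [Fintype κ] (C : ℝ)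
    (m : κ → ℝ) (P : Matrix κ κ ℝ) (u : ι → ℝ) (x : κ → ℝ) :
    gEntry C (Sum.elim (0 : ι → ℝ) m) (fromBlocks 0 0 0 P) (Sum.elim u x) = gEntry C m P x := by
  have hw : Sum.elim u x - Sum.elim (0 : ι → ℝ) m = Sum.elim u (x - m) := by
    ext (i | i) <;> simp
  simp [gEntry, hw, fromBlocks_mulVec, sumElim_dotProduct_sumElim]

theorem posSemidef_fromBlocks_diag {ι κ : Type*} [Fintype ι] [Fintype κ] {P : Matrix ι ι ℝ}
    {Q : Matrix κ κ ℝ} (hP : P.PosSemidef) (hQ : Q.PosSemidef) :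
    (fromBlocks P 0 0 Q).PosSemidef := by
  refine .of_dotProduct_mulVec_nonneg (hP.1.fromBlocks (by simp) hQ.1) fun x => ?_
  have h₁ := hP.dotProduct_mulVec_nonneg (x ∘ Sum.inl)
  have h₂ := hQ.dotProduct_mulVec_nonneg (x ∘ Sum.inr)
  obtain ⟨a, b, rfl⟩ : ∃ a b, x = Sum.elim a b := ⟨_, _, (Sum.elim_comp_inl_inr x).symm⟩
  simpa [fromBlocks_mulVec, sumElim_dotProduct_sumElim] using add_nonneg h₁ h₂

/-- The integrand of a filtering step, for one entry of each of the three models, is a Gaussian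
entry in the pair of state variables. -/
theorem exists_gEntry_filter {ι κ : Type*} [Fintype ι] [Fintype κ]
    (C₁ C₂ C₃ : ℝ) (m₁ : ι ⊕ ι → ℝ) (m₂ : ι ⊕ κ → ℝ) (m₃ : ι → ℝ)
    {P₁ : Matrix (ι ⊕ ι) (ι ⊕ ι) ℝ} {P₂ : Matrix (ι ⊕ κ) (ι ⊕ κ) ℝ} {P₃ : Matrix ι ι ℝ}
    (h₁ : P₁.PosDef) (h₂ : P₂.PosDef) (h₃ : P₃.PosDef) (y : κ → ℝ) :
    ∃ (C : ℝ) (m : ι ⊕ ι → ℝ) (P : Matrix (ι ⊕ ι) (ι ⊕ ι) ℝ), P.PosDef ∧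
      ∀ u x, gEntry C₁ m₁ P₁ (Sum.elim u x) * gEntry C₂ m₂ P₂ (Sum.elim x y) *
        gEntry C₃ m₃ P₃ u = gEntry C m P (Sum.elim u x) := by
  obtain ⟨c, A, n, S, hA, -, h⟩ := exists_gEntry_sumElim_eq C₂ m₂ h₂
  have hy : ∀ x, gEntry C₂ m₂ P₂ (Sum.elim x y) =
      gEntry (Real.log (gEntry C₂ n S y) + 0) (c y) A x := fun x => by
    rw [h, mul_comm, mul_gEntry (gEntry_pos _ _ _ _)]
  have hA' : (fromBlocks 0 0 0 A : Matrix (ι ⊕ ι) (ι ⊕ ι) ℝ).PosSemidef :=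
    posSemidef_fromBlocks_diag .zero hA.posSemidef
  have h₃' : (fromBlocks P₃ 0 0 0 : Matrix (ι ⊕ ι) (ι ⊕ ι) ℝ).PosSemidef :=
    posSemidef_fromBlocks_diag h₃.posSemidef .zero
  obtain ⟨C', m', e'⟩ := exists_gEntry_mul_gEntry_s11 C₁ (Real.log (gEntry C₂ n S y) + 0) m₁
    (Sum.elim 0 (c y)) h₁ hA'
  obtain ⟨C, m, e⟩ := exists_gEntry_mul_gEntry_s11 C' C₃ m' (Sum.elim m₃ 0)
    (h₁.add_posSemidef hA') h₃'
  refine ⟨C, m, _, (h₁.add_posSemidef hA').add_posSemidef h₃', fun u x => ?_⟩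
  rw [hy, ← e, ← e', gEntry_fromBlocks_zero, gEntry_fromBlocks_zero']

/-- Marginalizing a Gaussian entry over the first variable gives a Gaussian entry. -/
theorem exists_integral_gEntry {ι κ : Type*} [Fintype ι] [Fintype κ] (C : ℝ)
    (m : ι ⊕ κ → ℝ) {P : Matrix (ι ⊕ κ) (ι ⊕ κ) ℝ} (hP : P.PosDef) :
    (∀ x, Integrable fun u : ι → ℝ => gEntry C m P (Sum.elim u x)) ∧
    ∃ (C' : ℝ) (n : κ → ℝ) (S : Matrix κ κ ℝ), S.PosSemidef ∧
      ∀ x, ∫ u : ι → ℝ, gEntry C m P (Sum.elim u x) = gEntry C' n S x := by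
  obtain ⟨c, A, n, S, hA, hS, h⟩ := exists_gEntry_sumElim_eq C m hP
  simp only [h]
  refine ⟨fun x => (integrable_gEntry _ _ hA).mul_const _,
    Real.log (∫ u, gEntry 0 0 A u) + C, n, S, hS, fun x => ?_⟩
  rw [integral_mul_const]
  simp only [gEntry_sub 0 (c x)]
  rw [integral_sub_right_eq_self (gEntry 0 0 A) (c x), mul_gEntry (integral_gEntry_pos 0 0 hA)]

theorem integral_sum_sum_mul {α ι : Type*} [MeasurableSpace α] [Fintype ι] {ν : Measure α}
    (A : ι → ι → ℝ) {B : α → ι → ι → ℝ}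
    (hint : ∀ i j, Integrable (fun a => B a i j) ν) :
    ∫ a, ∑ i, ∑ j, A i j * B a i j ∂ν = ∑ i, ∑ j, A i j * ∫ a, B a i j ∂ν := by
  rw [integral_finsetSum _ fun i _ => integrable_finsetSum _ fun j _ => (hint i j).const_mul _]
  refine Finset.sum_congr rfl fun i _ => ?_
  rw [integral_finsetSum _ fun j _ => (hint i j).const_mul _]
  simp only [integral_const_mul]

/-- Entrywise integrals of positive semidefinite matrices are positive semidefinite. -/
theorem posSemidef_integral {α ι : Type*} [MeasurableSpace α] [Fintype ι] {ν : Measure α}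
    {B : α → Matrix ι ι ℝ} (hB : ∀ a, (B a).PosSemidef)
    (hint : ∀ i j, Integrable (fun a => B a i j) ν) :
    (Matrix.of fun i j => ∫ a, B a i j ∂ν).PosSemidef := by
  refine .of_dotProduct_mulVec_nonneg ?_ fun v => ?_
  · ext i j
    simp only [conjTranspose_apply, of_apply, star_trivial]
    exact integral_congr_ae (.of_forall fun a => by simpa using (hB a).1.apply i j)
  · have : star v ⬝ᵥ (Matrix.of fun i j => ∫ a, B a i j ∂ν) *ᵥ v =
        ∫ a, star v ⬝ᵥ B a *ᵥ v ∂ν := by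
      simp only [dotProduct, mulVec, of_apply]
      rw [integral_finsetSum _ fun i _ => (integrable_finsetSum _ fun j _ =>
        (hint i j).mul_const _).const_mul _]
      refine Finset.sum_congr rfl fun i _ => ?_
      rw [integral_const_mul, integral_finsetSum _ fun j _ => (hint i j).mul_const _]
      simp only [integral_mul_const]
    rw [this]
    exact integral_nonneg fun a => (hB a).dotProduct_mulVec_nonneg v

open scoped Kronecker

theorem sum_mul_sum_eq_sum_kronecker {ι κ : Type*} [Fintype ι] [Fintype κ]
    (A a : Matrix ι ι ℝ) (B b : Matrix κ κ ℝ) :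
    (∑ i, ∑ j, A i j * a i j) * (∑ k, ∑ l, B k l * b k l) =
      ∑ p, ∑ q, (A ⊗ₖ B) p q * (a ⊗ₖ b) p q := by
  simp only [Fintype.sum_prod_type, kroneckerMap_apply, Finset.sum_mul_sum]
  refine Finset.sum_congr rfl fun i _ => Finset.sum_congr rfl fun k _ =>
    Finset.sum_congr rfl fun j _ => Finset.sum_congr rfl fun l _ => ?_
  ring

/-- Generalized Gaussian PSD models may be indexed by any type of the right cardinality. -/
theorem IsGenGaussianPSD.of_fintype {ι κ : Type*} [Fintype ι] [Fintype κ] {N : ℕ}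
    (hN : Fintype.card κ = N) {f : (ι → ℝ) → ℝ} {A : Matrix κ κ ℝ} {C : κ → κ → ℝ}
    {m : κ → κ → ι → ℝ} {P : κ → κ → Matrix ι ι ℝ} (hA : A.PosSemidef)
    (hP : ∀ i j, (P i j).PosSemidef)
    (hB : ∀ w : ι → ℝ, (Matrix.of fun i j => gEntry (C i j) (m i j) (P i j) w).PosSemidef)
    (hf : ∀ w, f w = ∑ i, ∑ j, A i j * gEntry (C i j) (m i j) (P i j) w) :
    IsGenGaussianPSD N f := by
  let e : Fin N ≃ κ := (Fintype.equivFinOfCardEq hN).symm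
  refine ⟨A.submatrix e e, fun i j => C (e i) (e j), fun i j => m (e i) (e j),
    fun i j => P (e i) (e j), hA.submatrix e, fun i j => hP _ _, fun w => (hB w).submatrix e,
    fun w => ?_⟩
  rw [hf, ← e.sum_comp]
  refine Finset.sum_congr rfl fun i _ => ?_
  rw [← e.sum_comp]
  rfl

/-- one filtering step with Generalized Gaussian PSD models `μ` (order `M`),
`q` (order `M_q`) and `g` (order `M_g`) with positive definite precision matrices yields,
after normalization, a Generalized Gaussian PSD model of order at most `M·M_q·M_g`. -/
theorem generalized_psd_filter_step
    (d d' M Mq Mg : ℕ)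
    -- the model μ on ℝ^d
    (Aμ : Matrix (Fin M) (Fin M) ℝ) (hAμ : Aμ.PosSemidef)
    (Cμ : Fin M → Fin M → ℝ) (mμ : Fin M → Fin M → Fin d → ℝ)
    (Pμ : Fin M → Fin M → Matrix (Fin d) (Fin d) ℝ)
    (hPμ : ∀ i j, (Pμ i j).PosDef)
    (hBμ : ∀ u : Fin d → ℝ,
      (Matrix.of fun i j => gEntry (Cμ i j) (mμ i j) (Pμ i j) u).PosSemidef)
    (μ : (Fin d → ℝ) → ℝ)
    (hμ : ∀ u, μ u = ∑ i, ∑ j, Aμ i j * gEntry (Cμ i j) (mμ i j) (Pμ i j) u)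
    -- the model q on ℝ^{2d}
    (Aq : Matrix (Fin Mq) (Fin Mq) ℝ) (hAq : Aq.PosSemidef)
    (Cq : Fin Mq → Fin Mq → ℝ) (mq : Fin Mq → Fin Mq → (Fin d ⊕ Fin d) → ℝ)
    (Pq : Fin Mq → Fin Mq → Matrix (Fin d ⊕ Fin d) (Fin d ⊕ Fin d) ℝ)
    (hPq : ∀ i j, (Pq i j).PosDef)
    (hBq : ∀ w : (Fin d ⊕ Fin d) → ℝ,
      (Matrix.of fun i j => gEntry (Cq i j) (mq i j) (Pq i j) w).PosSemidef)
    (q : (Fin d → ℝ) → (Fin d → ℝ) → ℝ)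
    (hq : ∀ u x, q u x =
      ∑ i, ∑ j, Aq i j * gEntry (Cq i j) (mq i j) (Pq i j) (Sum.elim u x))
    -- the model g on ℝ^{d+d'}
    (Ag : Matrix (Fin Mg) (Fin Mg) ℝ) (hAg : Ag.PosSemidef)
    (Cg : Fin Mg → Fin Mg → ℝ) (mg : Fin Mg → Fin Mg → (Fin d ⊕ Fin d') → ℝ)
    (Pg : Fin Mg → Fin Mg → Matrix (Fin d ⊕ Fin d') (Fin d ⊕ Fin d') ℝ)
    (hPg : ∀ i j, (Pg i j).PosDef)
    (hBg : ∀ w : (Fin d ⊕ Fin d') → ℝ,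
      (Matrix.of fun i j => gEntry (Cg i j) (mg i j) (Pg i j) w).PosSemidef)
    (g : (Fin d → ℝ) → (Fin d' → ℝ) → ℝ)
    (hg : ∀ x y, g x y =
      ∑ i, ∑ j, Ag i j * gEntry (Cg i j) (mg i j) (Pg i j) (Sum.elim x y))
    -- the observation and the normalization constant
    (y : Fin d' → ℝ) (Z : ℝ)
    (hZdef : Z = ∫ x : Fin d → ℝ, ∫ u : Fin d → ℝ, q u x * g x y * μ u)
    (hZpos : 0 < Z) :
    IsGenGaussianPSD (M * Mq * Mg)
      (fun x : Fin d → ℝ => (∫ u : Fin d → ℝ, q u x * g x y * μ u) / Z) := by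
  let E : (Fin d → ℝ) → (Fin d → ℝ) → Matrix ((Fin Mq × Fin Mg) × Fin M)
      ((Fin Mq × Fin Mg) × Fin M) ℝ := fun x u =>
    ((Matrix.of fun i j => gEntry (Cq i j) (mq i j) (Pq i j) (Sum.elim u x)) ⊗ₖ
      (Matrix.of fun i j => gEntry (Cg i j) (mg i j) (Pg i j) (Sum.elim x y))) ⊗ₖ
      (Matrix.of fun i j => gEntry (Cμ i j) (mμ i j) (Pμ i j) u)
  have hE : ∀ x u, (E x u).PosSemidef := fun x u =>
    ((hBq _).kronecker (hBg _)).kronecker (hBμ u)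
  have hprod : ∀ x u, q u x * g x y * μ u = ∑ s, ∑ t, ((Aq ⊗ₖ Ag) ⊗ₖ Aμ) s t * E x u s t := by
    intro x u
    rw [hq, hg, hμ]
    exact (congrArg (· * _) (sum_mul_sum_eq_sum_kronecker Aq
      (Matrix.of fun i j => gEntry (Cq i j) (mq i j) (Pq i j) (Sum.elim u x)) Ag
      (Matrix.of fun i j => gEntry (Cg i j) (mg i j) (Pg i j) (Sum.elim x y)))).trans
      (sum_mul_sum_eq_sum_kronecker _ _ Aμ
        (Matrix.of fun i j => gEntry (Cμ i j) (mμ i j) (Pμ i j) u))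
  have hmarg : ∀ s t, (∀ x, Integrable fun u => E x u s t) ∧
      ∃ (C : ℝ) (n : Fin d → ℝ) (S : Matrix (Fin d) (Fin d) ℝ), S.PosSemidef ∧
        ∀ x, ∫ u, E x u s t = gEntry C n S x := by
    intro s t
    obtain ⟨C, m, P, hP, h⟩ := exists_gEntry_filter (Cq s.1.1 t.1.1) (Cg s.1.2 t.1.2) (Cμ s.2 t.2)
      (mq s.1.1 t.1.1) (mg s.1.2 t.1.2) (mμ s.2 t.2) (hPq s.1.1 t.1.1) (hPg s.1.2 t.1.2)
      (hPμ s.2 t.2) y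
    have hEP : ∀ x u, E x u s t = gEntry C m P (Sum.elim u x) := fun x u => h u x
    simp only [hEP]
    exact exists_integral_gEntry C m hP
  have hint := fun s t => (hmarg s t).1
  choose C n S hS hI using fun s t => (hmarg s t).2
  refine IsGenGaussianPSD.of_fintype (κ := (Fin Mq × Fin Mg) × Fin M)
    (A := Z⁻¹ • ((Aq ⊗ₖ Ag) ⊗ₖ Aμ)) (C := C) (m := n) (P := S)
    (by simp only [Fintype.card_prod, Fintype.card_fin]; ring)
    (((hAq.kronecker hAg).kronecker hAμ).smul (inv_nonneg.2 hZpos.le)) hS (fun x => ?_)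
    fun x => ?_
  · simp only [← hI]
    exact posSemidef_integral (hE x) fun s t => hint s t x
  · simp only [hprod, ← hI]
    refine (congrArg (· / Z) (integral_sum_sum_mul _ fun s t => hint s t x)).trans ?_
    simp only [Finset.sum_div, Matrix.smul_apply, smul_eq_mul]
    refine Finset.sum_congr rfl fun s _ => Finset.sum_congr rfl fun t _ => ?_
    ring
end
end

section
/- Let (E, 𝒜, λ) be a measure space, let 0 < σ < 1 and let (r_n)_{n≥1} be a sequence of measurable kernels r_n : E × E → [0,∞), each σ-ξ_n-mixing for some probability density ξ_n on E. For a probability density ρ on E define the filtered sequence π_0^ρ = ρ and π_n^ρ = (r_n π_{n−1}^ρ) / ∫_E (r_n π_{n−1}^ρ) dλ, where (r_n p)(x) = ∫_E r_n(u,x) p(u) dλ(u). Then for any two probability densities μ and ν on E, and every n ≥ 1, ‖π_n^ν − π_n^μ‖_TV ≤ (2 / (σ² log 3)) · ((1 − σ²)/(1 + σ²))^{n−1} · ‖μ − ν‖_TV. -/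
open MeasureTheory
open scoped BigOperators

noncomputable section

/-- The normalized filtering step `R̄(p) = (r p) / ∫ (r p) dλ`, where
`(r p)(x) = ∫ r(u,x) p(u) dλ(u)`. -/
def filterStep {E : Type*} [MeasurableSpace E] (lam : Measure E)
    (r : E → E → ℝ) (p : E → ℝ) : E → ℝ :=
  fun x => (∫ u, r u x * p u ∂lam) / ∫ x', (∫ u, r u x' * p u ∂lam) ∂lam

/-- `p` is a probability density with respect to `lam`. -/
structure IsDensity {E : Type*} [MeasurableSpace E] (lam : Measure E) (p : E → ℝ) : Prop where
  nonneg : ∀ x, 0 ≤ p x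
  integrable : Integrable p lam
  integral_eq_one : ∫ x, p x ∂lam = 1

/-- The kernel `r` is measurable and `σ`-`ξ`-mixing for the probability density `ξ`. -/
structure IsMixing {E : Type*} [MeasurableSpace E] (lam : Measure E) (σ : ℝ)
    (r : E → E → ℝ) (ξ : E → ℝ) : Prop where
  measurable : Measurable (Function.uncurry r)
  density : IsDensity lam ξ
  lower : ∀ u x, σ * ξ x ≤ r u x
  upper : ∀ u x, r u x ≤ ξ x / σ

/-- The backward action `(r f)(u) = ∫ r(u,x) f(x) dλ(x)` of a kernel on functions. -/
def backward {E : Type*} [MeasurableSpace E] (lam : Measure E)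
    (r : E → E → ℝ) (f : E → ℝ) : E → ℝ :=
  fun u => ∫ x, r u x * f x ∂lam

/-- The measurable functions `h`, `F` satisfy `c ≤ h ≤ c / σ ^ 2` and `a h ≤ F ≤ b h`. -/
structure IsComparable {E : Type*} [MeasurableSpace E] (σ c a b : ℝ) (h F : E → ℝ) : Prop where
  measurable_left : Measurable h
  measurable_right : Measurable F
  pos : 0 < c
  le_left : ∀ x, c ≤ h x
  left_le : ∀ x, h x ≤ c / σ ^ 2
  lower : ∀ x, a * h x ≤ F x
  upper : ∀ x, F x ≤ b * h x

/-- The interval containing all ratios `f / (f + g)` with `f ∈ [σ A, A / σ]` and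
`g ∈ [σ B, B / σ]` has length at most `(1 - σ ^ 2) / (1 + σ ^ 2)`. -/
lemma ratio_sub_ratio_le {k A B : ℝ} (hk0 : 0 < k) (hk1 : k < 1) (hA : 0 ≤ A) (hB : 0 ≤ B) :
    A / (A + k * B) - k * A / (k * A + B) ≤ (1 - k) / (1 + k) := by
  rcases hA.eq_or_lt with rfl | hA
  · simp only [zero_div, mul_zero, sub_zero]
    exact div_nonneg (by linarith) (by linarith)
  rcases hB.eq_or_lt with rfl | hB
  · simp only [mul_zero, add_zero]
    rw [div_self hA.ne', div_self (mul_pos hk0 hA).ne', sub_self]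
    exact div_nonneg (by linarith) (by linarith)
  have h1 : 0 < A + k * B := by positivity
  have h2 : 0 < k * A + B := by positivity
  rw [div_sub_div _ _ h1.ne' h2.ne', div_le_div_iff₀ (by positivity) (by positivity)]
  have : 0 ≤ (1 - k) * (k * (A - B) ^ 2) := mul_nonneg (by linarith) (by positivity)
  nlinarith

lemma ratio_lower {σ A B f g : ℝ} (hσ : 0 < σ) (hA : 0 ≤ A) (hB : 0 ≤ B)
    (hf : σ * A ≤ f) (hg : g ≤ B / σ) :
    σ ^ 2 * A / (σ ^ 2 * A + B) * (f + g) ≤ f := by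
  have hf0 : 0 ≤ f := le_trans (by positivity) hf
  rcases (show 0 ≤ σ ^ 2 * A + B by positivity).eq_or_lt with h | h
  · rw [← h]; simpa
  rw [div_mul_eq_mul_div, div_le_iff₀ h]
  have h1 : g * σ ≤ B := (le_div_iff₀ hσ).1 hg
  have h2 : g * σ * (σ * A) ≤ B * (σ * A) := mul_le_mul_of_nonneg_right h1 (by positivity)
  have h3 : σ * A * B ≤ f * B := mul_le_mul_of_nonneg_right hf hB
  nlinarith

lemma ratio_upper {σ A B f g : ℝ} (hσ : 0 < σ) (hA : 0 ≤ A) (hB : 0 ≤ B)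
    (hf : f ≤ A / σ) (hg : σ * B ≤ g) :
    f ≤ A / (A + σ ^ 2 * B) * (f + g) := by
  have h1 : f * σ ≤ A := (le_div_iff₀ hσ).1 hf
  rcases (show 0 ≤ A + σ ^ 2 * B by positivity).eq_or_lt with h | h
  · have hA0 : A = 0 := by nlinarith [mul_nonneg (sq_nonneg σ) hB]
    rw [← h, div_zero, zero_mul]
    simpa [hA0] using hf
  rw [div_mul_eq_mul_div, le_div_iff₀ h]
  have h2 : f * σ * (σ * B) ≤ A * (σ * B) := mul_le_mul_of_nonneg_right h1 (by positivity)
  have h3 : A * (σ * B) ≤ A * g := mul_le_mul_of_nonneg_left hg hA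
  nlinarith

lemma log_three_le : Real.log 3 ≤ 4 / 3 := by
  rw [Real.log_le_iff_le_exp (by norm_num)]
  have := Real.quadratic_le_exp_of_nonneg (show (0 : ℝ) ≤ 4 / 3 by norm_num)
  norm_num at this ⊢
  linarith

section

variable {E : Type*} [MeasurableSpace E] {lam : Measure E} {σ : ℝ}

lemma IsMixing.nonneg {r : E → E → ℝ} {ξ : E → ℝ} (hr : IsMixing lam σ r ξ) (hσ : 0 < σ)
    (u x : E) : 0 ≤ r u x :=
  (mul_nonneg hσ.le (hr.density.nonneg x)).trans (hr.lower u x)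

lemma IsMixing.integrable {r : E → E → ℝ} {ξ : E → ℝ} (hr : IsMixing lam σ r ξ) (hσ : 0 < σ)
    (u : E) : Integrable (r u) lam := by
  refine (hr.density.integrable.div_const σ).mono'
    (hr.measurable.comp measurable_prodMk_left).aestronglyMeasurable (.of_forall fun x => ?_)
  rw [Real.norm_of_nonneg (hr.nonneg hσ u x)]
  exact hr.upper u x

lemma Integrable.mul_bounded {p f : E → ℝ} {C : ℝ} (hp : Integrable p lam) (hf : Measurable f)
    (hC : ∀ x, |f x| ≤ C) : Integrable (fun x => p x * f x) lam :=
  hp.mul_bdd hf.aestronglyMeasurable (.of_forall hC)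

lemma IsMixing.backward_bounds {r : E → E → ℝ} {ξ f : E → ℝ} {C : ℝ} (hr : IsMixing lam σ r ξ)
    (hσ : 0 < σ) (hf : Measurable f) (hC : ∀ x, |f x| ≤ C) (hf0 : ∀ x, 0 ≤ f x) (u : E) :
    σ * (∫ x, ξ x * f x ∂lam) ≤ backward lam r f u ∧
      backward lam r f u ≤ (∫ x, ξ x * f x ∂lam) / σ := by
  have h1 : Integrable (fun x => ξ x * f x) lam :=
    Integrable.mul_bounded hr.density.integrable hf hC
  have h2 : Integrable (fun x => r u x * f x) lam :=
    Integrable.mul_bounded (hr.integrable hσ u) hf hC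
  constructor
  · rw [← integral_const_mul]
    refine integral_mono (h1.const_mul σ) h2 fun x => ?_
    simpa [mul_assoc] using mul_le_mul_of_nonneg_right (hr.lower u x) (hf0 x)
  · rw [← integral_div]
    refine integral_mono h2 (h1.div_const σ) fun x => ?_
    have := mul_le_mul_of_nonneg_right (hr.upper u x) (hf0 x)
    calc r u x * f x ≤ ξ x / σ * f x := this
      _ = ξ x * f x / σ := by ring

lemma IsComparable.left_nonneg {c a b : ℝ} {h F : E → ℝ} (hF : IsComparable σ c a b h F) (x : E) :
    0 ≤ h x :=
  hF.pos.le.trans (hF.le_left x)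

lemma IsComparable.abs_left_le {c a b : ℝ} {h F : E → ℝ} (hF : IsComparable σ c a b h F) (x : E) :
    |h x| ≤ c / σ ^ 2 := by
  rw [abs_of_nonneg (hF.left_nonneg x)]
  exact hF.left_le x

lemma IsComparable.abs_right_le {c a b : ℝ} {h F : E → ℝ} (hF : IsComparable σ c a b h F)
    (x : E) : |F x| ≤ (|a| + |b|) * (c / σ ^ 2) := by
  have h0 := hF.left_nonneg x
  have h1 := hF.left_le x
  have : |F x| ≤ (|a| + |b|) * h x := by
    rw [abs_le]
    constructor
    · nlinarith [hF.lower x, mul_le_mul_of_nonneg_right (neg_abs_le a) h0,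
        mul_nonneg (abs_nonneg b) h0]
    · nlinarith [hF.upper x, mul_le_mul_of_nonneg_right (le_abs_self b) h0,
        mul_nonneg (abs_nonneg a) h0]
  exact this.trans (mul_le_mul_of_nonneg_left h1 (by positivity))

lemma measurable_backward [SFinite lam] {r : E → E → ℝ} {f : E → ℝ}
    (hr : Measurable (Function.uncurry r)) (hf : Measurable f) : Measurable (backward lam r f) := by
  have : StronglyMeasurable (Function.uncurry fun u x => r u x * f x) :=
    (hr.mul (hf.comp measurable_snd)).stronglyMeasurable
  exact this.integral_prod_right.measurable

/-- The backward action of a mixing kernel contracts the range of the ratio `F / h` by the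
factor `(1 - σ ^ 2) / (1 + σ ^ 2)`. -/
lemma IsComparable.backward_contracts [SFinite lam] {r : E → E → ℝ} {ξ h F : E → ℝ} {c a b : ℝ}
    (hr : IsMixing lam σ r ξ) (hσ0 : 0 < σ) (hσ1 : σ < 1) (hab : a ≤ b)
    (hF : IsComparable σ c a b h F) :
    ∃ c' a' b', a' ≤ b' ∧ b' - a' ≤ (1 - σ ^ 2) / (1 + σ ^ 2) * (b - a) ∧
      IsComparable σ c' a' b' (backward lam r h) (backward lam r F) := by
  have hσ2 : 0 < σ ^ 2 := by positivity
  have hσ21 : σ ^ 2 < 1 := by nlinarith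
  have ihξ : Integrable (fun x => ξ x * h x) lam :=
    Integrable.mul_bounded hr.density.integrable hF.measurable_left hF.abs_left_le
  have hI : c ≤ ∫ x, ξ x * h x ∂lam := by
    calc c = ∫ x, ξ x * c ∂lam := by
          rw [integral_mul_const, hr.density.integral_eq_one, one_mul]
      _ ≤ _ := integral_mono (hr.density.integrable.mul_const c) ihξ fun x =>
          mul_le_mul_of_nonneg_left (hF.le_left x) (hr.density.nonneg x)
  have hbh := hr.backward_bounds hσ0 hF.measurable_left hF.abs_left_le hF.left_nonneg
  set I := ∫ x, ξ x * h x ∂lam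
  have hIpos : 0 < I := hF.pos.trans_le hI
  set C := (|a| + |b|) * (c / σ ^ 2)
  have hgap (x : E) : (b - a) * h x ≤ C := by
    calc (b - a) * h x ≤ (|a| + |b|) * h x := mul_le_mul_of_nonneg_right
          (by linarith [neg_abs_le a, le_abs_self b]) (hF.left_nonneg x)
      _ ≤ _ := mul_le_mul_of_nonneg_left (hF.left_le x) (by positivity)
  have hfm : Measurable fun x => F x - a * h x :=
    hF.measurable_right.sub (hF.measurable_left.const_mul a)
  have hgm : Measurable fun x => b * h x - F x :=
    (hF.measurable_left.const_mul b).sub hF.measurable_right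
  have hf0 (x : E) : 0 ≤ F x - a * h x := sub_nonneg.2 (hF.lower x)
  have hg0 (x : E) : 0 ≤ b * h x - F x := sub_nonneg.2 (hF.upper x)
  have hfC (x : E) : |F x - a * h x| ≤ C := by
    rw [abs_of_nonneg (hf0 x)]
    linarith [hgap x, hg0 x]
  have hgC (x : E) : |b * h x - F x| ≤ C := by
    rw [abs_of_nonneg (hg0 x)]
    linarith [hgap x, hf0 x]
  have hbf := hr.backward_bounds hσ0 hfm hfC hf0
  have hbg := hr.backward_bounds hσ0 hgm hgC hg0
  have hA : 0 ≤ ∫ x, ξ x * (F x - a * h x) ∂lam :=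
    integral_nonneg fun x => mul_nonneg (hr.density.nonneg x) (hf0 x)
  have hB : 0 ≤ ∫ x, ξ x * (b * h x - F x) ∂lam :=
    integral_nonneg fun x => mul_nonneg (hr.density.nonneg x) (hg0 x)
  set A := ∫ x, ξ x * (F x - a * h x) ∂lam
  set B := ∫ x, ξ x * (b * h x - F x) ∂lam
  have hih (u : E) : Integrable (fun x => r u x * h x) lam :=
    Integrable.mul_bounded (hr.integrable hσ0 u) hF.measurable_left hF.abs_left_le
  have hiF (u : E) : Integrable (fun x => r u x * F x) lam :=
    Integrable.mul_bounded (hr.integrable hσ0 u) hF.measurable_right hF.abs_right_le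
  have ef (u : E) : backward lam r (fun x => F x - a * h x) u =
      backward lam r F u - a * backward lam r h u := by
    simp only [backward]
    rw [← integral_const_mul, ← integral_sub (hiF u) ((hih u).const_mul a)]
    congr 1 with x
    ring
  have eg (u : E) : backward lam r (fun x => b * h x - F x) u =
      b * backward lam r h u - backward lam r F u := by
    simp only [backward]
    rw [← integral_const_mul, ← integral_sub ((hih u).const_mul b) (hiF u)]
    congr 1 with x
    ring
  have hba : 0 ≤ b - a := sub_nonneg.2 hab
  have hlow (u : E) : (a + (b - a) * (σ ^ 2 * A / (σ ^ 2 * A + B))) * backward lam r h u ≤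
      backward lam r F u := by
    have := ratio_lower hσ0 hA hB (hbf u).1 (hbg u).2
    rw [ef, eg] at this
    linarith
  have hupp (u : E) : backward lam r F u ≤
      (a + (b - a) * (A / (A + σ ^ 2 * B))) * backward lam r h u := by
    have := ratio_upper hσ0 hA hB (hbf u).2 (hbg u).1
    rw [ef, eg] at this
    linarith
  have hE : Nonempty E := by
    by_contra hE
    rw [not_nonempty_iff] at hE
    have := hr.density.integral_eq_one
    rw [integral_of_isEmpty] at this
    norm_num at this
  have hhpos (u : E) : 0 < backward lam r h u := lt_of_lt_of_le (by positivity) (hbh u).1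
  refine ⟨σ * I, a + (b - a) * (σ ^ 2 * A / (σ ^ 2 * A + B)),
    a + (b - a) * (A / (A + σ ^ 2 * B)), ?_, ?_, ?_⟩
  · obtain ⟨u⟩ := hE
    exact le_of_mul_le_mul_right ((hlow u).trans (hupp u)) (hhpos u)
  · have := mul_le_mul_of_nonneg_left (ratio_sub_ratio_le hσ2 hσ21 hA hB) hba
    linarith
  · refine ⟨measurable_backward hr.measurable hF.measurable_left,
      measurable_backward hr.measurable hF.measurable_right, by positivity,
      fun u => (hbh u).1, fun u => ?_, hlow, hupp⟩
    convert (hbh u).2 using 1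
    field_simp

lemma IsMixing.integrable_prod [SFinite lam] {r : E → E → ℝ} {ξ p : E → ℝ}
    (hr : IsMixing lam σ r ξ) (hσ : 0 < σ) (hp : Integrable p lam) :
    Integrable (fun z : E × E => r z.1 z.2 * p z.1) (lam.prod lam) := by
  refine (hp.norm.mul_prod (hr.density.integrable.div_const σ)).mono'
    (hr.measurable.aestronglyMeasurable.mul hp.aestronglyMeasurable.comp_fst)
    (.of_forall fun z => ?_)
  rw [norm_mul, Real.norm_of_nonneg (hr.nonneg hσ _ _), mul_comm]
  exact mul_le_mul_of_nonneg_left (hr.upper _ _) (norm_nonneg _)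

lemma IsMixing.integrable_forward [SFinite lam] {r : E → E → ℝ} {ξ p : E → ℝ}
    (hr : IsMixing lam σ r ξ) (hσ : 0 < σ) (hp : Integrable p lam) :
    Integrable (fun x => ∫ u, r u x * p u ∂lam) lam :=
  (hr.integrable_prod hσ hp).integral_prod_right

lemma IsMixing.le_forward {r : E → E → ℝ} {ξ p : E → ℝ}
    (hr : IsMixing lam σ r ξ) (hσ : 0 < σ) (hp : IsDensity lam p) (x : E) :
    σ * ξ x ≤ ∫ u, r u x * p u ∂lam := by
  have hi : Integrable (fun u => r u x * p u) lam := by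
    refine hp.integrable.bdd_mul (c := ξ x / σ)
      (hr.measurable.comp measurable_prodMk_right).aestronglyMeasurable (.of_forall fun u => ?_)
    have := hr.upper u x
    simpa [Function.uncurry, abs_of_nonneg (hr.nonneg hσ u x)]
  calc σ * ξ x = ∫ u, σ * ξ x * p u ∂lam := by
        rw [integral_const_mul, hp.integral_eq_one, mul_one]
    _ ≤ _ := integral_mono (hp.integrable.const_mul _) hi fun u =>
        mul_le_mul_of_nonneg_right (hr.lower u x) (hp.nonneg u)

lemma IsMixing.integral_forward_pos [SFinite lam] {r : E → E → ℝ} {ξ p : E → ℝ}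
    (hr : IsMixing lam σ r ξ) (hσ : 0 < σ) (hp : IsDensity lam p) :
    0 < ∫ x, (∫ u, r u x * p u ∂lam) ∂lam := by
  calc 0 < σ := hσ
    _ = ∫ x, σ * ξ x ∂lam := by rw [integral_const_mul, hr.density.integral_eq_one, mul_one]
    _ ≤ _ := integral_mono (hr.density.integrable.const_mul _)
      (hr.integrable_forward hσ hp.integrable) fun x => hr.le_forward hσ hp x

lemma IsDensity.filterStep [SFinite lam] {r : E → E → ℝ} {ξ p : E → ℝ}
    (hp : IsDensity lam p) (hr : IsMixing lam σ r ξ) (hσ : 0 < σ) :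
    IsDensity lam (filterStep lam r p) where
  nonneg x := div_nonneg
    (integral_nonneg fun u => mul_nonneg (hr.nonneg hσ u x) (hp.nonneg u))
    (hr.integral_forward_pos hσ hp).le
  integrable := (hr.integrable_forward hσ hp.integrable).div_const _
  integral_eq_one := by
    simp only [_root_.filterStep]
    rw [integral_div, div_self (hr.integral_forward_pos hσ hp).ne']

/-- Up to normalization, `filterStep` is adjoint to `backward`. -/
lemma IsMixing.integral_mul_backward [SFinite lam] {r : E → E → ℝ} {ξ p f : E → ℝ} {C : ℝ}
    (hr : IsMixing lam σ r ξ) (hσ : 0 < σ) (hp : IsDensity lam p)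
    (hf : Measurable f) (hC : ∀ x, |f x| ≤ C) :
    ∫ u, p u * backward lam r f u ∂lam =
      (∫ x, (∫ u, r u x * p u ∂lam) ∂lam) * ∫ x, filterStep lam r p x * f x ∂lam := by
  have hi : Integrable (Function.uncurry fun u x => r u x * p u * f x) (lam.prod lam) :=
    (hr.integrable_prod hσ hp.integrable).mul_bdd (hf.comp measurable_snd).aestronglyMeasurable
      (.of_forall fun z => hC z.2)
  have h1 (u : E) : p u * backward lam r f u = ∫ x, r u x * p u * f x ∂lam := by
    rw [backward, ← integral_const_mul]
    congr 1 with x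
    ring
  have hZ := (hr.integral_forward_pos hσ hp).ne'
  simp_rw [h1]
  rw [integral_integral_swap hi, ← integral_const_mul]
  congr 1 with x
  rw [integral_mul_const, filterStep]
  field_simp

/-- A pair of functions can be pulled back along `n` filtering steps, with contraction of the
range of their ratio. -/
lemma exists_pullback [SFinite lam] (hσ0 : 0 < σ) (hσ1 : σ < 1) {r : ℕ → E → E → ℝ}
    {ξ : ℕ → E → ℝ} (hr : ∀ n, IsMixing lam σ (r (n + 1)) (ξ (n + 1))) (n : ℕ) :
    ∀ {c a b : ℝ} {h F : E → ℝ}, a ≤ b → IsComparable σ c a b h F →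
      ∃ c' a' b' h' F', a' ≤ b' ∧ b' - a' ≤ ((1 - σ ^ 2) / (1 + σ ^ 2)) ^ n * (b - a) ∧
        IsComparable σ c' a' b' h' F' ∧
        ∀ π : ℕ → E → ℝ, IsDensity lam (π 0) →
          (∀ k, π (k + 1) = filterStep lam (r (k + 1)) (π k)) →
          ∃ Z : ℝ, 0 < Z ∧ ∫ x, π 0 x * h' x ∂lam = Z * ∫ x, π n x * h x ∂lam ∧
            ∫ x, π 0 x * F' x ∂lam = Z * ∫ x, π n x * F x ∂lam := by
  induction n with
  | zero =>
    intro c a b h F hab hF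
    exact ⟨c, a, b, h, F, hab, by simp, hF, fun π _ _ => ⟨1, one_pos, by simp, by simp⟩⟩
  | succ n ih =>
    intro c a b h F hab hF
    obtain ⟨c₁, a₁, b₁, hab₁, hlen₁, hF₁⟩ := hF.backward_contracts (hr n) hσ0 hσ1 hab
    obtain ⟨c', a', b', h', F', hab', hlen', hF', hπ⟩ := ih hab₁ hF₁
    refine ⟨c', a', b', h', F', hab', hlen'.trans ?_, hF', fun π h0 hstep => ?_⟩
    · rw [pow_succ _ n, mul_assoc]
      exact mul_le_mul_of_nonneg_left hlen₁
        (pow_nonneg (div_nonneg (by nlinarith) (by positivity)) _)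
    · obtain ⟨Z, hZ, e1, e2⟩ := hπ π h0 hstep
      have hd : ∀ k, IsDensity lam (π k) := by
        intro k
        induction k with
        | zero => exact h0
        | succ k ihk => rw [hstep]; exact ihk.filterStep (hr k) hσ0
      refine ⟨Z * ∫ x, (∫ u, r (n + 1) u x * π n u ∂lam) ∂lam,
        mul_pos hZ ((hr n).integral_forward_pos hσ0 (hd n)), ?_, ?_⟩
      · rw [e1, (hr n).integral_mul_backward hσ0 (hd n) hF.measurable_left hF.abs_left_le,
          hstep, mul_assoc]
      · rw [e2, (hr n).integral_mul_backward hσ0 (hd n) hF.measurable_right hF.abs_right_le,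
          hstep, mul_assoc]

lemma abs_integral_sub_mul_le {p q f : E → ℝ} {C : ℝ} (hp : Integrable p lam)
    (hq : Integrable q lam) (hf : Measurable f) (hC : ∀ x, |f x| ≤ C) :
    |∫ x, p x * f x ∂lam - ∫ x, q x * f x ∂lam| ≤ C * ∫ x, |p x - q x| ∂lam := by
  rw [← integral_sub (Integrable.mul_bounded hp hf hC) (Integrable.mul_bounded hq hf hC),
    ← integral_const_mul]
  refine (abs_integral_le_integral_abs).trans
    (integral_mono_of_nonneg (.of_forall fun x => abs_nonneg _)
      ((hp.sub hq).abs.const_mul C) (.of_forall fun x => ?_))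
  simp only [← sub_mul, abs_mul]
  rw [mul_comm]
  exact mul_le_mul_of_nonneg_right (hC x) (abs_nonneg _)

/-- Reweighting two densities by a comparable pair of functions. -/
lemma IsComparable.ratio_sub_ratio_le {c a b : ℝ} {h F p q : E → ℝ}
    (hF : IsComparable σ c a b h F) (hσ : 0 < σ) (hab : a ≤ b)
    (hp : IsDensity lam p) (hq : IsDensity lam q) :
    (∫ x, p x * F x ∂lam) / (∫ x, p x * h x ∂lam) -
        (∫ x, q x * F x ∂lam) / (∫ x, q x * h x ∂lam) ≤
      3 / 4 * (b - a) / σ ^ 2 * ∫ x, |p x - q x| ∂lam := by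
  set m := (a + b) / 2 with hm
  set d := (b - a) / 2 with hd
  have hd0 : 0 ≤ d := by rw [hd]; linarith
  set C := c / σ ^ 2 with hC
  have hc := hF.pos
  have hC0 : 0 < C := by positivity
  set δ := ∫ x, |p x - q x| ∂lam
  have hδ : 0 ≤ δ := integral_nonneg fun x => abs_nonneg _
  have ih {p : E → ℝ} (hp : IsDensity lam p) : Integrable (fun x => p x * h x) lam :=
    Integrable.mul_bounded hp.integrable hF.measurable_left hF.abs_left_le
  have iF {p : E → ℝ} (hp : IsDensity lam p) : Integrable (fun x => p x * F x) lam :=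
    Integrable.mul_bounded hp.integrable hF.measurable_right hF.abs_right_le
  have hlow {p : E → ℝ} (hp : IsDensity lam p) : c ≤ ∫ x, p x * h x ∂lam := by
    calc c = ∫ x, p x * c ∂lam := by rw [integral_mul_const, hp.integral_eq_one, one_mul]
      _ ≤ _ := integral_mono (hp.integrable.mul_const c) (ih hp) fun x =>
          mul_le_mul_of_nonneg_left (hF.le_left x) (hp.nonneg x)
  have hGm : Measurable fun x => F x - m * h x :=
    hF.measurable_right.sub (hF.measurable_left.const_mul m)
  have hGh (x : E) : |F x - m * h x| ≤ d * h x := by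
    have h1 := hF.lower x
    have h2 := hF.upper x
    rw [abs_le, hd, hm]
    constructor <;> linarith
  have hGC (x : E) : |F x - m * h x| ≤ d * C :=
    (hGh x).trans (mul_le_mul_of_nonneg_left (hF.left_le x) hd0)
  have eG {p : E → ℝ} (hp : IsDensity lam p) : ∫ x, p x * (F x - m * h x) ∂lam =
      ∫ x, p x * F x ∂lam - m * ∫ x, p x * h x ∂lam := by
    rw [← integral_const_mul, ← integral_sub (iF hp) ((ih hp).const_mul m)]
    congr 1 with x
    ring
  have hG := abs_integral_sub_mul_le hp.integrable hq.integrable hGm hGC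
  have hqG : |∫ x, q x * (F x - m * h x) ∂lam| ≤ d * ∫ x, q x * h x ∂lam := by
    rw [← integral_const_mul]
    refine (abs_integral_le_integral_abs).trans
      (integral_mono_of_nonneg (.of_forall fun x => abs_nonneg _)
        ((ih hq).const_mul d) (.of_forall fun x => ?_))
    simp only [abs_mul, abs_of_nonneg (hq.nonneg x)]
    nlinarith [mul_le_mul_of_nonneg_left (hGh x) (hq.nonneg x)]
  have hh : |∫ x, p x * h x ∂lam - ∫ x, q x * h x ∂lam| ≤ C / 2 * δ := by
    have h1 : ∀ x, |h x - C / 2| ≤ C / 2 := fun x => by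
      rw [abs_le]
      constructor <;> linarith [hF.left_nonneg x, hF.left_le x]
    have h2 := abs_integral_sub_mul_le hp.integrable hq.integrable
      (hF.measurable_left.sub_const _) h1
    have e {p : E → ℝ} (hp : IsDensity lam p) : ∫ x, p x * (h x - C / 2) ∂lam =
        ∫ x, p x * h x ∂lam - C / 2 := by
      simp_rw [mul_sub]
      rw [integral_sub (ih hp) (hp.integrable.mul_const _), integral_mul_const,
        hp.integral_eq_one, one_mul]
    rw [e hp, e hq] at h2
    simpa using h2
  rw [eG hp, eG hq] at hG
  rw [eG hq] at hqG
  have hPh := hlow hp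
  have hQh := hlow hq
  generalize ∫ x, p x * h x ∂lam = P at *
  generalize ∫ x, q x * h x ∂lam = Q at *
  generalize ∫ x, p x * F x ∂lam = S at *
  generalize ∫ x, q x * F x ∂lam = T at *
  have hP0 : 0 < P := hc.trans_le hPh
  have hQ0 : 0 < Q := hc.trans_le hQh
  have key : S / P - T / Q =
      ((S - m * P) - (T - m * Q) + (T - m * Q) / Q * (Q - P)) / P := by
    field_simp
    ring
  have hmid : (T - m * Q) / Q * (Q - P) ≤ d * (C / 2 * δ) := by
    refine (le_abs_self _).trans ?_
    rw [abs_mul]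
    refine mul_le_mul ?_ (by rwa [abs_sub_comm]) (abs_nonneg _) hd0
    rwa [abs_div, abs_of_pos hQ0, div_le_iff₀ hQ0]
  rw [key, div_le_iff₀ hP0]
  calc _ ≤ d * C * δ + d * (C / 2 * δ) := add_le_add ((le_abs_self _).trans hG) hmid
    _ = 3 / 4 * (b - a) / σ ^ 2 * δ * c := by rw [hd, hC]; ring
    _ ≤ _ := mul_le_mul_of_nonneg_left hPh (by
      have : 0 ≤ b - a := sub_nonneg.2 hab
      positivity)

theorem optimal_filter_stability_of_sFinite [SFinite lam] (hσ0 : 0 < σ) (hσ1 : σ < 1)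
    {r : ℕ → E → E → ℝ} {ξ : ℕ → E → ℝ}
    (hr : ∀ n, IsMixing lam σ (r (n + 1)) (ξ (n + 1))) {πμ πν : ℕ → E → ℝ}
    (hμ : IsDensity lam (πμ 0)) (hν : IsDensity lam (πν 0))
    (hπμ : ∀ n, πμ (n + 1) = filterStep lam (r (n + 1)) (πμ n))
    (hπν : ∀ n, πν (n + 1) = filterStep lam (r (n + 1)) (πν n)) (n : ℕ) :
    ∫ x, |πν n x - πμ n x| ∂lam ≤
      3 / 2 / σ ^ 2 * ((1 - σ ^ 2) / (1 + σ ^ 2)) ^ n * ∫ x, |πμ 0 x - πν 0 x| ∂lam := by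
  have hd {π : ℕ → E → ℝ} (h0 : IsDensity lam (π 0))
      (hstep : ∀ k, π (k + 1) = filterStep lam (r (k + 1)) (π k)) : IsDensity lam (π n) := by
    induction n with
    | zero => exact h0
    | succ k ihk => rw [hstep]; exact ihk.filterStep (hr k) hσ0
  have dμ := hd hμ hπμ
  have dν := hd hν hπν
  have him := (dν.integrable.sub dμ.integrable).aestronglyMeasurable
  set g := him.mk _
  have hg : ∀ᵐ x ∂lam, πν n x - πμ n x = g x := him.ae_eq_mk
  have hgm : Measurable g := him.stronglyMeasurable_mk.measurable
  set φ : E → ℝ := fun x => if 0 ≤ g x then 1 else -1 with hφ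
  have hφm : Measurable φ :=
    Measurable.ite (measurableSet_le measurable_const hgm) measurable_const measurable_const
  have hφb (x : E) : |φ x| ≤ 1 := by
    simp only [hφ]; split_ifs <;> simp
  have hcomp : IsComparable σ 1 (-1) 1 (fun _ => 1) φ := by
    refine ⟨measurable_const, hφm, one_pos, fun _ => le_rfl, fun _ => ?_, fun x => ?_,
      fun x => ?_⟩
    · rw [le_div_iff₀ (by positivity)]
      nlinarith
    · linarith [(abs_le.1 (hφb x)).1]
    · linarith [(abs_le.1 (hφb x)).2]
  obtain ⟨c, a, b, h, F, hab, hlen, hF, hZ⟩ :=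
    exists_pullback hσ0 hσ1 hr n (by norm_num) hcomp
  have hratio {π : ℕ → E → ℝ} (h0 : IsDensity lam (π 0))
      (hstep : ∀ k, π (k + 1) = filterStep lam (r (k + 1)) (π k)) :
      ∫ x, π n x * φ x ∂lam = (∫ x, π 0 x * F x ∂lam) / ∫ x, π 0 x * h x ∂lam := by
    obtain ⟨Z, hZ0, e1, e2⟩ := hZ π h0 hstep
    rw [e1, e2]
    simp only [mul_one]
    rw [(hd h0 hstep).integral_eq_one]
    field_simp
  have htv : ∫ x, |πν n x - πμ n x| ∂lam = ∫ x, πν n x * φ x ∂lam - ∫ x, πμ n x * φ x ∂lam := by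
    rw [← integral_sub (Integrable.mul_bounded dν.integrable hφm hφb)
      (Integrable.mul_bounded dμ.integrable hφm hφb)]
    refine integral_congr_ae ?_
    filter_upwards [hg] with x hx
    rw [← sub_mul, hx]
    simp only [hφ]
    split_ifs with h0
    · rw [abs_of_nonneg h0, mul_one]
    · rw [abs_of_neg (not_le.1 h0)]; ring
  rw [htv, hratio hν hπν, hratio hμ hπμ]
  refine (hF.ratio_sub_ratio_le hσ0 hab hν hμ).trans ?_
  simp_rw [abs_sub_comm (πν 0 _)]
  refine mul_le_mul_of_nonneg_right ?_ (integral_nonneg fun x => abs_nonneg _)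
  rw [div_mul_eq_mul_div (3 / 2)]
  refine (div_le_div_iff_of_pos_right (pow_pos hσ0 2)).2 ?_
  linarith

lemma sFinite_restrict_iUnion {s : ℕ → Set E} (hs : ∀ n, MeasurableSet (s n))
    (h : ∀ n, SFinite (lam.restrict (s n))) : SFinite (lam.restrict (⋃ n, s n)) := by
  rw [← iUnion_disjointed, Measure.restrict_iUnion (disjoint_disjointed s)
    (MeasurableSet.disjointed hs)]
  have (n : ℕ) : SFinite (lam.restrict (disjointed s n)) := by
    rw [← Measure.restrict_restrict_of_subset (disjointed_subset s n)]
    infer_instance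
  infer_instance

lemma exists_sFinite_support {f : ℕ → E → ℝ} (hf : ∀ n, Integrable (f n) lam) :
    ∃ S, SFinite (lam.restrict S) ∧ ∀ n, ∀ᵐ x ∂lam, x ∉ S → f n x = 0 := by
  have hsupp (n : ℕ) : ∃ s, MeasurableSet s ∧ f n =ᵐ[lam.restrict sᶜ] 0 ∧
      SigmaFinite (lam.restrict s) := (hf n).aefinStronglyMeasurable.exists_set_sigmaFinite
  choose s hs hzero hfin using hsupp
  refine ⟨⋃ n, s n, sFinite_restrict_iUnion hs fun n => by have := hfin n; infer_instance,
    fun n => ?_⟩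
  filter_upwards [(ae_restrict_iff' (hs n).compl).1 (hzero n)] with x hx hxS
  exact hx fun h => hxS (Set.mem_iUnion_of_mem n h)

lemma IsDensity.restrict {p : E → ℝ} {S : Set E} (hp : IsDensity lam p)
    (hS : ∀ᵐ x ∂lam, x ∉ S → p x = 0) : IsDensity (lam.restrict S) p :=
  ⟨hp.nonneg, hp.integrable.restrict, by
    rw [setIntegral_eq_integral_of_ae_compl_eq_zero hS, hp.integral_eq_one]⟩

lemma IsMixing.forward_eq_zero {r : E → E → ℝ} {ξ p : E → ℝ} {S : Set E}
    (hr : IsMixing lam σ r ξ) (hσ : 0 < σ) (hξ : ∀ᵐ x ∂lam, x ∉ S → ξ x = 0) :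
    ∀ᵐ x ∂lam, x ∉ S → ∫ u, r u x * p u ∂lam = 0 := by
  filter_upwards [hξ] with x hx hxS
  have h0 (u : E) : r u x = 0 := le_antisymm (by simpa [hx hxS] using hr.upper u x)
    (hr.nonneg hσ u x)
  simp [h0]

lemma IsMixing.filterStep_restrict {r : E → E → ℝ} {ξ p : E → ℝ} {S : Set E}
    (hr : IsMixing lam σ r ξ) (hσ : 0 < σ) (hξ : ∀ᵐ x ∂lam, x ∉ S → ξ x = 0)
    (hp : ∀ᵐ x ∂lam, x ∉ S → p x = 0) :
    filterStep (lam.restrict S) r p = filterStep lam r p := by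
  have h1 (x : E) : ∫ u in S, r u x * p u ∂lam = ∫ u, r u x * p u ∂lam :=
    setIntegral_eq_integral_of_ae_compl_eq_zero (by
      filter_upwards [hp] with u hu huS
      rw [hu huS, mul_zero])
  unfold filterStep
  simp_rw [h1]
  rw [setIntegral_eq_integral_of_ae_compl_eq_zero (hr.forward_eq_zero hσ hξ)]

lemma ae_eq_zero_of_filterStep {r : ℕ → E → E → ℝ} {ξ π : ℕ → E → ℝ} {S : Set E}
    (hr : ∀ n, IsMixing lam σ (r (n + 1)) (ξ (n + 1))) (hσ : 0 < σ)
    (hξ : ∀ n, ∀ᵐ x ∂lam, x ∉ S → ξ (n + 1) x = 0) (h0 : ∀ᵐ x ∂lam, x ∉ S → π 0 x = 0)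
    (hπ : ∀ n, π (n + 1) = filterStep lam (r (n + 1)) (π n)) (n : ℕ) :
    ∀ᵐ x ∂lam, x ∉ S → π n x = 0 := by
  cases n with
  | zero => exact h0
  | succ n =>
    filter_upwards [(hr n).forward_eq_zero (p := π n) hσ (hξ n)] with x hx hxS
    rw [hπ, filterStep, hx hxS, zero_div]

end

/-- stability (forgetting) of the optimal filter under mixing kernels:
for any two initial probability densities `μ, ν`,
`‖π_n^ν − π_n^μ‖_TV ≤ (2/(σ² log 3)) ((1−σ²)/(1+σ²))^{n−1} ‖μ − ν‖_TV`. -/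
theorem optimal_filter_stability
    {E : Type*} [MeasurableSpace E] (lam : Measure E)
    (σ : ℝ) (hσ0 : 0 < σ) (hσ1 : σ < 1)
    (r : ℕ → E → E → ℝ)
    (hrmeas : ∀ n, 1 ≤ n → Measurable (Function.uncurry (r n)))
    (hr0 : ∀ n, 1 ≤ n → ∀ u x, 0 ≤ r n u x)
    (ξ : ℕ → E → ℝ)
    (hξ0 : ∀ n, 1 ≤ n → ∀ x, 0 ≤ ξ n x)
    (hξint : ∀ n, 1 ≤ n → Integrable (ξ n) lam)
    (hξ1 : ∀ n, 1 ≤ n → ∫ x, ξ n x ∂lam = 1)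
    (hmix : ∀ n, 1 ≤ n → ∀ u x, σ * ξ n x ≤ r n u x ∧ r n u x ≤ ξ n x / σ)
    (μ ν : E → ℝ)
    (hμ0 : ∀ x, 0 ≤ μ x) (hμint : Integrable μ lam) (hμ1 : ∫ x, μ x ∂lam = 1)
    (hν0 : ∀ x, 0 ≤ ν x) (hνint : Integrable ν lam) (hν1 : ∫ x, ν x ∂lam = 1)
    (πμ πν : ℕ → E → ℝ)
    (hπμ0 : πμ 0 = μ) (hπν0 : πν 0 = ν)
    (hπμ : ∀ n : ℕ, πμ (n + 1) = filterStep lam (r (n + 1)) (πμ n))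
    (hπν : ∀ n : ℕ, πν (n + 1) = filterStep lam (r (n + 1)) (πν n)) :
    ∀ n : ℕ, 1 ≤ n →
      (∫ x, |πν n x - πμ n x| ∂lam) ≤
        (2 / (σ ^ 2 * Real.log 3)) * ((1 - σ ^ 2) / (1 + σ ^ 2)) ^ (n - 1) *
          ∫ x, |μ x - ν x| ∂lam := by
  have hr : ∀ n, IsMixing lam σ (r (n + 1)) (ξ (n + 1)) := fun n =>
    have hn : 1 ≤ n + 1 := Nat.le_add_left 1 n
    ⟨hrmeas _ hn, ⟨hξ0 _ hn, hξint _ hn, hξ1 _ hn⟩, fun u x => (hmix _ hn u x).1,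
      fun u x => (hmix _ hn u x).2⟩
  have dμ : IsDensity lam μ := ⟨hμ0, hμint, hμ1⟩
  have dν : IsDensity lam ν := ⟨hν0, hνint, hν1⟩
  obtain ⟨S, hS, hzero⟩ := exists_sFinite_support (lam := lam)
    (f := fun n => Nat.casesOn n μ fun k => Nat.casesOn k ν fun j => ξ (j + 1)) (fun n => by
      rcases n with _ | _ | n
      · exact hμint
      · exact hνint
      · exact hξint _ (Nat.le_add_left 1 n))
  have zμ : ∀ᵐ x ∂lam, x ∉ S → μ x = 0 := hzero 0
  have zν : ∀ᵐ x ∂lam, x ∉ S → ν x = 0 := hzero 1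
  have zξ (n : ℕ) : ∀ᵐ x ∂lam, x ∉ S → ξ (n + 1) x = 0 := hzero (n + 2)
  have zπμ := ae_eq_zero_of_filterStep hr hσ0 zξ (by rwa [hπμ0]) hπμ
  have zπν := ae_eq_zero_of_filterStep hr hσ0 zξ (by rwa [hπν0]) hπν
  have hrS : ∀ n, IsMixing (lam.restrict S) σ (r (n + 1)) (ξ (n + 1)) := fun n =>
    ⟨(hr n).measurable, (hr n).density.restrict (zξ n), (hr n).lower, (hr n).upper⟩
  intro n hn
  have main := optimal_filter_stability_of_sFinite hσ0 hσ1 hrS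
    (πμ := πμ) (πν := πν) (by rw [hπμ0]; exact dμ.restrict zμ) (by rw [hπν0]; exact dν.restrict zν)
    (fun k => by rw [hπμ, (hr k).filterStep_restrict hσ0 (zξ k) (zπμ k)])
    (fun k => by rw [hπν, (hr k).filterStep_restrict hσ0 (zξ k) (zπν k)]) n
  rw [hπμ0, hπν0, setIntegral_eq_integral_of_ae_compl_eq_zero (by
      filter_upwards [zπμ n, zπν n] with x h1 h2 hx
      simp [h1 hx, h2 hx]),
    setIntegral_eq_integral_of_ae_compl_eq_zero (by
      filter_upwards [zμ, zν] with x h1 h2 hx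
      simp [h1 hx, h2 hx])] at main
  refine main.trans (mul_le_mul_of_nonneg_right ?_ (integral_nonneg fun x => abs_nonneg _))
  have hσ2 : 0 < σ ^ 2 := by positivity
  have hlog : 0 < Real.log 3 := Real.log_pos (by norm_num)
  have hτ0 : 0 ≤ (1 - σ ^ 2) / (1 + σ ^ 2) := div_nonneg (by nlinarith) (by positivity)
  have hτ1 : (1 - σ ^ 2) / (1 + σ ^ 2) ≤ 1 := by
    rw [div_le_one (by positivity)]; linarith
  refine mul_le_mul ?_ (pow_le_pow_of_le_one hτ0 hτ1 (Nat.sub_le n 1)) (pow_nonneg hτ0 _)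
    (by positivity)
  rw [div_div, div_le_div_iff₀ (by positivity) (by positivity)]
  nlinarith [mul_le_mul_of_nonneg_left log_three_le hσ2.le]
end
end
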